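/- Let G be a finitely generated nilpotent group equipped with a generating k-tuple S = (s₁,…,s_k), with word-length |·| and volume growth function V. Let ℓ:[0,∞)→(0,∞) be continuous, increasing, slowly varying at infinity, and assume Σ_{g∈G} 1/(V(1+|g|) ℓ(1+|g|)) < ∞. Define probability measures ν(g) = c/(V(1+|g|) ℓ(1+|g|)) (c a normalizing constant) and μ(g) = k^{-1} Σ_{i=1}^k Σ_{n∈ℤ} b·1_{s_i^n}(g)/((1+n)ℓ(1+n)) (b a normalizing constant). Then there exists a constant C such that E_μ(f,f) ≤ C·E_ν(f,f) for all f ∈ L²(G). -/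

import Mathlib

open MeasureTheory Filter Topology Set
open scoped Classical BigOperators

noncomputable section

/-- Word length of `g` with respect to a set `S` of generators. -/
def wordLen {G : Type*} [Group G] (S : Set G) (g : G) : ℕ :=
  sInf {n | ∃ w : List G, (∀ x ∈ w, x ∈ S) ∧ w.length = n ∧ w.prod = g}

/-- The symmetric set associated with a generating tuple. -/
def symSet {G : Type*} [Group G] {k : ℕ} (s : Fin k → G) : Set G :=
  {x | ∃ i, x = s i ∨ x = (s i)⁻¹}

/-- Volume function: number of elements of word length at most `n`. -/
def vol {G : Type*} [Group G] (S : Set G) (n : ℕ) : ℕ :=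
  Set.ncard {g : G | wordLen S g ≤ n}

/-- `S` is a finite symmetric generating set. -/
def IsSymmGen {G : Type*} [Group G] (S : Set G) : Prop :=
  S.Finite ∧ (∀ x ∈ S, x⁻¹ ∈ S) ∧ Subgroup.closure S = ⊤

/-- Polynomial volume growth of degree `D`. -/
def PolyGrowth {G : Type*} [Group G] (S : Set G) (D : ℕ) : Prop :=
  ∃ c C : ℝ, 0 < c ∧ 0 < C ∧ ∀ n : ℕ, 1 ≤ n →
    c * (n : ℝ) ^ D ≤ (vol S n : ℝ) ∧ (vol S n : ℝ) ≤ C * (n : ℝ) ^ D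

/-- A symmetric probability measure on `G`, viewed as a density. -/
def IsSymmProb {G : Type*} [Group G] (μ : G → ℝ) : Prop :=
  (∀ g, 0 ≤ μ g) ∧ Summable μ ∧ (∑' g, μ g) = 1 ∧ (∀ g, μ g⁻¹ = μ g)

/-- Convolution of two densities on `G`. -/
def conv {G : Type*} [Group G] (μ ν : G → ℝ) : G → ℝ :=
  fun g => ∑' h, μ h * ν (h⁻¹ * g)

/-- Convolution powers `μ^{(n)}`. -/
def convPow {G : Type*} [Group G] (μ : G → ℝ) : ℕ → G → ℝ
  | 0 => fun g => if g = 1 then 1 else 0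
  | n + 1 => conv μ (convPow μ n)

/-- Mass a density gives to a set. -/
def massOf {G : Type*} (μ : G → ℝ) (A : Set G) : ℝ := ∑' g : A, μ (g : G)

/-- The weak `ρ`-moment of `μ` is bounded by `M`:
`sup_{s>0} s·μ({g : ρ(|g|) > s}) ≤ M`. -/
def WeakMomentLe {G : Type*} [Group G] (S : Set G) (ρ : ℝ → ℝ) (μ : G → ℝ) (M : ℝ) : Prop :=
  ∀ s : ℝ, 0 < s → s * massOf μ {g | ρ ((wordLen S g : ℝ)) > s} ≤ M

/-- `Φ̃_{G,ρ}(n)`: fastest decay of `φ^{(2n)}(e)` under the weak `ρ`-moment condition. -/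
def PhiTilde {G : Type*} [Group G] (S : Set G) (ρ : ℝ → ℝ) (n : ℕ) : ℝ :=
  sInf {x | ∃ μ : G → ℝ, IsSymmProb μ ∧ WeakMomentLe S ρ μ 2 ∧ x = convPow μ (2 * n) 1}

/-- Slow variation at infinity. -/
def SlowlyVarying (l : ℝ → ℝ) : Prop :=
  ∀ lam : ℝ, 0 < lam → Tendsto (fun x => l (lam * x) / l x) atTop (nhds 1)

/-- `ls` is a de Bruijn conjugate of the slowly varying function `l`. -/
def IsDeBruijnConjugate (l ls : ℝ → ℝ) : Prop :=
  SlowlyVarying ls ∧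
  Tendsto (fun x => l x * ls (x * l x)) atTop (nhds 1) ∧
  Tendsto (fun x => ls x * l (x * ls x)) atTop (nhds 1)

/-- Iterated logarithms: `log_{[0]} x = x`, `log_{[j]} x = log(1 + log_{[j-1]} x)`. -/
def logIter : ℕ → ℝ → ℝ
  | 0, x => x
  | n + 1, x => Real.log (1 + logIter n x)

/-- Base 2 iterated logarithms: `log_{2,1}(s) = log₂(1+s)`, `log_{2,j} = log_{2,1} ∘ log_{2,j-1}`. -/
def log2Iter : ℕ → ℝ → ℝ
  | 0, x => x
  | n + 1, x => Real.logb 2 (1 + log2Iter n x)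

/-- `θ(s) = 1/∫_0^{1/s} dt/(t ℓ(1/t))`. -/
def thetaOf (l : ℝ → ℝ) (s : ℝ) : ℝ :=
  1 / ∫ t in Set.Ioc (0:ℝ) (1/s), 1 / (t * l (1/t))

/-- Dirichlet form `E_μ(f,f) = (1/2) Σ_{x,y} |f(xy)-f(x)|² μ(y)`. -/
def dirichlet {G : Type*} [Group G] (μ : G → ℝ) (f : G → ℝ) : ℝ :=
  (1/2) * ∑' p : G × G, |f (p.1 * p.2) - f p.1| ^ 2 * μ p.2

/-- `f ∈ ℓ²(G)` (counting measure). -/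
def MemL2 {G : Type*} (f : G → ℝ) : Prop := Summable (fun x => (f x) ^ 2)

/-- Bernstein representation `ψ(s) = a + bs + ∫ (1-e^{-st}) dν(t)`,
with `ν` supported in `(0,∞)` and `∫ t/(1+t) dν < ∞`. -/
def IsBernsteinRep (ψ : ℝ → ℝ) (a b : ℝ) (ν : Measure ℝ) : Prop :=
  0 ≤ a ∧ 0 ≤ b ∧ ν (Set.Iic 0) = 0 ∧
  Integrable (fun t => t / (1 + t)) ν ∧
  ∀ s : ℝ, 0 < s → ψ s = a + b * s + ∫ t, (1 - Real.exp (-(s * t))) ∂ν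

/-- Bernstein function (via the classical representation). -/
def IsBernstein (ψ : ℝ → ℝ) : Prop := ∃ a b ν, IsBernsteinRep ψ a b ν

/-- Complete Bernstein function: `ψ(s) = s² ∫_0^∞ e^{-ts} g(t) dt` with `g` Bernstein. -/
def IsCompleteBernstein (ψ : ℝ → ℝ) : Prop :=
  ∃ g : ℝ → ℝ, IsBernstein g ∧
    ∀ s : ℝ, 0 < s → ψ s = s ^ 2 * ∫ t in Set.Ioi (0:ℝ), Real.exp (-(t * s)) * g t

/-- Subordination coefficients `c(ψ,n)` computed from representation data `(b,ν)`:
`c(ψ,1) = b + ∫ t e^{-t} dν`, `c(ψ,n) = (1/n!) ∫ tⁿ e^{-t} dν` for `n > 1`. -/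
def cPsi (b : ℝ) (ν : Measure ℝ) (n : ℕ) : ℝ :=
  if n = 0 then 0
  else (if n = 1 then b else 0) + (1 / (n.factorial : ℝ)) * ∫ t, t ^ n * Real.exp (-t) ∂ν

/-- Subordinated measure `Σ_{n} c(n) φ^{(n)}`. -/
def subord {G : Type*} [Group G] (φ : G → ℝ) (c : ℕ → ℝ) : G → ℝ :=
  fun x => ∑' n : ℕ, c n * convPow φ n x

/-- Tail `H_φ(r) = Σ_{|n|>r} φ(n)` of a measure on `ℤ`. -/
def Hphi (φ : ℤ → ℝ) (r : ℝ) : ℝ := ∑' n : ℤ, if r < (|n| : ℝ) then φ n else 0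

/-- Truncated second moment `G_φ(r) = Σ_{|n|≤r} n² φ(n)`. -/
def Gphi (φ : ℤ → ℝ) (r : ℝ) : ℝ := ∑' n : ℤ, if (|n| : ℝ) ≤ r then (n : ℝ) ^ 2 * φ n else 0

/-- `E_{s,φ}(f,f) = (1/2) Σ_{x∈G} Σ_{n∈ℤ} |f(xsⁿ)-f(x)|² φ(n)`. -/
def EsPhi {G : Type*} [Group G] (s : G) (φ : ℤ → ℝ) (f : G → ℝ) : ℝ :=
  (1/2) * ∑' p : G × ℤ, |f (p.1 * s ^ p.2) - f p.1| ^ 2 * φ p.2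

/-- Symmetric probability measure on `ℤ`. -/
def IsSymmProbZ (φ : ℤ → ℝ) : Prop :=
  (∀ n, 0 ≤ φ n) ∧ Summable φ ∧ (∑' n, φ n) = 1 ∧ (∀ n, φ (-n) = φ n)

/-- Measure supported on powers of generators:
`μ(g) = k⁻¹ Σ_i Σ_{n∈ℤ} w(n) 1_{s_iⁿ}(g)`. -/
def genMeasure {G : Type*} [Group G] {k : ℕ} (s : Fin k → G) (w : ℤ → ℝ) : G → ℝ :=
  fun g => (k : ℝ)⁻¹ * ∑ i : Fin k, ∑' n : ℤ, if g = s i ^ n then w n else 0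

/-- Coefficients in `1-(1-x)^α = Σ_{n≥1} c_α(n) xⁿ`. -/
def cAlpha (a : ℝ) (n : ℕ) : ℝ :=
  if n = 0 then 0
  else (-1) ^ (n + 1) * (∏ j ∈ Finset.range n, (a - j)) / (n.factorial : ℝ)

namespace NC

open scoped commutatorElement

inductive Tr (k : ℕ) : Type
  | lf (i : Fin k) (b : Bool) : Tr k
  | br (x y : Tr k) : Tr k

def wt {k : ℕ} : Tr k → ℕ
  | Tr.lf _ _ => 1
  | Tr.br x y => wt x + wt y

def val {G : Type*} [Group G] {k : ℕ} (s : Fin k → G) : Tr k → G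
  | Tr.lf i b => if b then s i else (s i)⁻¹
  | Tr.br x y => (val s x)⁻¹ * (val s y)⁻¹ * val s x * val s y

def iv {k : ℕ} : Tr k → Tr k
  | Tr.lf i b => Tr.lf i (!b)
  | Tr.br x y => Tr.br y x

def cs {k : ℕ} (n : ℕ) (z : Tr k) : ℝ := ((n : ℝ) ^ wt z)⁻¹

theorem wt_pos {k : ℕ} (z : Tr k) : 1 ≤ wt z := by
  induction z with
  | lf i b => simp [wt]
  | br x y hx hy => simp only [wt]; omega

theorem wt_iv {k : ℕ} (z : Tr k) : wt (iv z) = wt z := by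
  cases z with
  | lf i b => rfl
  | br x y => simp only [wt, iv]; omega

theorem cs_iv {k : ℕ} (n : ℕ) (z : Tr k) : cs n (iv z) = cs n z := by
  simp only [cs, wt_iv]

theorem cs_nonneg {k : ℕ} (n : ℕ) (z : Tr k) : 0 ≤ cs n z := by
  unfold cs; positivity

theorem cs_br {k : ℕ} (n : ℕ) (x y : Tr k) : cs n (Tr.br x y) = cs n x * cs n y := by
  simp only [cs, wt, pow_add, mul_inv]

theorem finite_wt (k W : ℕ) : {z : Tr k | wt z ≤ W}.Finite := by
  induction W with
  | zero =>
    refine Set.Finite.subset Set.finite_empty ?_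
    intro z hz
    have := wt_pos z
    simp only [Set.mem_ofPred_eq] at hz
    omega
  | succ W ih =>
    refine Set.Finite.subset (((Set.finite_range (fun p : Fin k × Bool => Tr.lf p.1 p.2))).union
      (Set.Finite.image2 Tr.br ih ih)) ?_
    intro z hz
    cases z with
    | lf i b => exact Or.inl ⟨(i, b), rfl⟩
    | br x y =>
      right
      have hx := wt_pos x
      have hy := wt_pos y
      simp only [Set.mem_ofPred_eq, wt] at hz
      exact ⟨x, by simp only [Set.mem_ofPred_eq]; omega, y, by simp only [Set.mem_ofPred_eq]; omega, rfl⟩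

section
variable {G : Type*} [Group G] {k : ℕ} (s : Fin k → G)

theorem val_iv (z : Tr k) : val s (iv z) = (val s z)⁻¹ := by
  cases z with
  | lf i b => cases b <;> simp [val, iv]
  | br x y => simp only [val, iv]; group

theorem conj_val (x y : Tr k) :
    (val s y)⁻¹ * val s x * val s y = val s x * val s (Tr.br x y) := by
  simp only [val]; group

theorem val_mem_lcs (m : ℕ) : ∀ z : Tr k, 2 ^ m ≤ wt z →
    val s z ∈ (⊤ : Subgroup G).lowerCentralSeries m := by
  induction m with
  | zero => intro z _; simp
  | succ m ih =>
    intro z hz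
    cases z with
    | lf i b =>
      exfalso
      simp only [wt] at hz
      have : 2 ≤ 2 ^ (m+1) := by rw [pow_succ]; have := Nat.one_le_two_pow (n := m); omega
      omega
    | br x y =>
      simp only [wt, pow_succ] at hz
      have key : val s (Tr.br x y) = ⁅(val s x)⁻¹, (val s y)⁻¹⁆ := by
        simp only [val, commutatorElement_def, inv_inv]
      rw [key, Subgroup.lowerCentralSeries_succ]
      by_cases hx : 2 ^ m ≤ wt x
      · exact Subgroup.commutator_mem_commutator (inv_mem (ih x hx)) (Subgroup.mem_top _)
      · rw [← inv_mem_iff, commutatorElement_inv]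
        exact Subgroup.commutator_mem_commutator (inv_mem (ih y (by omega))) (Subgroup.mem_top _)

theorem exists_W [Group.IsNilpotent G] : ∃ W : ℕ, ∀ z : Tr k, W < wt z → val s z = 1 := by
  obtain ⟨m, hm⟩ := Subgroup.nilpotent_iff_lowerCentralSeries.1 (inferInstance : Group.IsNilpotent G)
  refine ⟨2 ^ m, fun z hz => ?_⟩
  have := val_mem_lcs s m z hz.le
  rw [hm] at this
  exact Subgroup.mem_bot.1 this

/-- words with letters in `T` of cost at most `A`. -/
inductive Cost (T : Set (Tr k)) (n : ℕ) : ℝ → G → Prop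
  | one {A : ℝ} (hA : 0 ≤ A) : Cost T n A 1
  | cons {A B : ℝ} {z : Tr k} {g : G} (hz : z ∈ T) (h : Cost T n A g) (hB : cs n z + A ≤ B) :
      Cost T n B (val s z * g)

/-- words with letters in `T` or equal to `t`, with exactly `q` letters `t`. -/
inductive Adm (T : Set (Tr k)) (t : Tr k) (n : ℕ) : ℕ → ℝ → G → Prop
  | one {A : ℝ} (hA : 0 ≤ A) : Adm T t n 0 A 1
  | hit {q : ℕ} {A B : ℝ} {g : G} (h : Adm T t n q A g) (hB : cs n t + A ≤ B) :
      Adm T t n (q + 1) B (val s t * g)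
  | cons {q : ℕ} {A B : ℝ} {z : Tr k} {g : G} (hz : z ∈ T) (h : Adm T t n q A g)
      (hB : cs n z + A ≤ B) : Adm T t n q B (val s z * g)

variable {s}

theorem Cost.nonneg {T : Set (Tr k)} {n : ℕ} {A : ℝ} {g : G} (h : Cost s T n A g) : 0 ≤ A := by
  induction h with
  | one hA => exact hA
  | cons hz h hB ih => have := cs_nonneg n (k := k); linarith [this ‹_›]

theorem Cost.mono {T : Set (Tr k)} {n : ℕ} {A B : ℝ} {g : G} (h : Cost s T n A g) (hAB : A ≤ B) :
    Cost s T n B g := by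
  cases h with
  | one hA => exact .one (hA.trans hAB)
  | cons hz h hB => exact .cons hz h (hB.trans hAB)

theorem Cost.monoT {T T' : Set (Tr k)} {n : ℕ} {A : ℝ} {g : G} (h : Cost s T n A g) (hT : T ⊆ T') :
    Cost s T' n A g := by
  induction h with
  | one hA => exact .one hA
  | cons hz h hB ih => exact .cons (hT hz) ih hB

theorem Cost.mul {T : Set (Tr k)} {n : ℕ} {A B : ℝ} {g h : G} (hg : Cost s T n A g)
    (hh : Cost s T n B h) : Cost s T n (A + B) (g * h) := by
  induction hg with
  | one hA => rw [one_mul]; exact hh.mono (by linarith)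
  | cons hz h hB ih => rw [mul_assoc]; exact .cons hz ih (by linarith)

theorem Cost.single {T : Set (Tr k)} {n : ℕ} {z : Tr k} (hz : z ∈ T) :
    Cost s T n (cs n z) (val s z) := by
  have := Cost.cons (s := s) (n := n) hz (.one le_rfl) (B := cs n z) (by simp)
  simpa using this

theorem Cost.pow {T : Set (Tr k)} {n : ℕ} {A : ℝ} {g : G} (hg : Cost s T n A g) (m : ℕ) :
    Cost s T n (m * A) (g ^ m) := by
  induction m with
  | zero => simpa using Cost.one (s := s) (T := T) (n := n) le_rfl
  | succ m ih => rw [pow_succ]; exact (ih.mul hg).mono (by push_cast; linarith)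

theorem Cost.inv {T : Set (Tr k)} (hT : ∀ z ∈ T, iv z ∈ T) {n : ℕ} {A : ℝ} {g : G}
    (hg : Cost s T n A g) : Cost s T n A g⁻¹ := by
  induction hg with
  | one hA => rw [inv_one]; exact .one hA
  | cons hz h hB ih =>
    rw [mul_inv_rev, ← val_iv]
    exact (ih.mul (Cost.single (hT _ hz))).mono (by rw [cs_iv]; linarith)

theorem Cost.conjL {T : Set (Tr k)} (hT : ∀ z ∈ T, ∀ y, Tr.br z y ∈ T) {n : ℕ} {A : ℝ} {g : G}
    (hg : Cost s T n A g) (y : Tr k) :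
    Cost s T n (A * (1 + cs n y)) ((val s y)⁻¹ * g * val s y) := by
  have hy := cs_nonneg n y
  induction hg with
  | one hA => simpa using Cost.one (s := s) (T := T) (n := n) (by positivity)
  | @cons A B z g hz h hB ih =>
    have e : (val s y)⁻¹ * (val s z * g) * val s y =
      val s z * (val s (Tr.br z y) * ((val s y)⁻¹ * g * val s y)) := by
      simp only [val]; group
    rw [e]
    refine .cons hz (.cons (hT z hz y) ih le_rfl) ?_
    rw [cs_br]
    nlinarith

theorem Cost.conj {T : Set (Tr k)} (hT : ∀ z ∈ T, ∀ y, Tr.br z y ∈ T) {T' : Set (Tr k)} {n : ℕ}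
    {A B : ℝ} {g y : G} (hy : Cost s T' n B y) (hg : Cost s T n A g) :
    Cost s T n (A * Real.exp B) (y⁻¹ * g * y) := by
  have hA := hg.nonneg
  induction hy generalizing g A with
  | one hB => simpa using hg.mono (by nlinarith [Real.one_le_exp hB])
  | @cons B B' z y hz h hB ih =>
    have := ih (hg.conjL hT z) (hg.conjL hT z).nonneg
    have e : (val s z * y)⁻¹ * g * (val s z * y) = y⁻¹ * ((val s z)⁻¹ * g * val s z) * y := by group
    rw [e]
    refine this.mono ?_
    have h1 : 1 + cs n z ≤ Real.exp (cs n z) := by linarith [Real.add_one_le_exp (cs n z)]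
    calc A * (1 + cs n z) * Real.exp B ≤ A * Real.exp (cs n z) * Real.exp B := by gcongr
      _ = A * Real.exp (cs n z + B) := by rw [Real.exp_add]; ring
      _ ≤ A * Real.exp B' := by gcongr

theorem Adm.nonneg {T : Set (Tr k)} {t : Tr k} {n q : ℕ} {A : ℝ} {g : G} (h : Adm s T t n q A g) :
    0 ≤ A := by
  induction h with
  | one hA => exact hA
  | hit h hB ih => linarith [cs_nonneg n t]
  | @cons _ _ _ z _ hz h hB ih => linarith [cs_nonneg n z]

theorem Adm.mono {T : Set (Tr k)} {t : Tr k} {n q : ℕ} {A B : ℝ} {g : G} (h : Adm s T t n q A g)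
    (hAB : A ≤ B) : Adm s T t n q B g := by
  cases h with
  | one hA => exact .one (hA.trans hAB)
  | hit h hB => exact .hit h (hB.trans hAB)
  | cons hz h hB => exact .cons hz h (hB.trans hAB)

theorem Adm.mul {T : Set (Tr k)} {t : Tr k} {n q r : ℕ} {A B : ℝ} {g h : G}
    (hg : Adm s T t n q A g) (hh : Adm s T t n r B h) : Adm s T t n (q + r) (A + B) (g * h) := by
  induction hg with
  | one hA => rw [one_mul, zero_add]; exact hh.mono (by linarith)
  | @hit q _ _ _ h hB ih =>
    rw [mul_assoc, show q + 1 + r = q + r + 1 by omega]; exact .hit ih (by linarith)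
  | cons hz h hB ih => rw [mul_assoc]; exact .cons hz ih (by linarith)

theorem Adm.ofCost {T : Set (Tr k)} {t : Tr k} {n : ℕ} {A : ℝ} {g : G} (h : Cost s T n A g) :
    Adm s T t n 0 A g := by
  induction h with
  | one hA => exact .one hA
  | cons hz h hB ih => exact .cons hz ih hB

theorem Adm.single {T : Set (Tr k)} {t : Tr k} {n : ℕ} : Adm s T t n 1 (cs n t) (val s t) := by
  have := Adm.hit (s := s) (n := n) (T := T) (t := t) (.one le_rfl) (B := cs n t) (by simp)
  simpa using this

theorem Adm.pow {T : Set (Tr k)} {t : Tr k} {n q : ℕ} {A : ℝ} {g : G}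
    (hg : Adm s T t n q A g) (m : ℕ) : Adm s T t n (m * q) (m * A) (g ^ m) := by
  induction m with
  | zero => simpa using Adm.one (s := s) (T := T) (t := t) (n := n) le_rfl
  | succ m ih =>
    rw [pow_succ, Nat.succ_mul]; exact (ih.mul hg).mono (by push_cast; linarith)

theorem Adm.conjL {T : Set (Tr k)} {t : Tr k} (hT : ∀ z ∈ T, ∀ y, Tr.br z y ∈ T)
    (ht : ∀ y, Tr.br t y ∈ T) {n q : ℕ} {A : ℝ} {g : G}
    (hg : Adm s T t n q A g) (y : Tr k) :
    Adm s T t n q (A * (1 + cs n y)) ((val s y)⁻¹ * g * val s y) := by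
  have hy := cs_nonneg n y
  induction hg with
  | one hA => simpa using Adm.one (s := s) (T := T) (t := t) (n := n) (by positivity)
  | @hit q A B g h hB ih =>
    have e : (val s y)⁻¹ * (val s t * g) * val s y =
      val s t * (val s (Tr.br t y) * ((val s y)⁻¹ * g * val s y)) := by
      simp only [val]; group
    rw [e]
    refine .hit (.cons (ht y) ih le_rfl) ?_
    rw [cs_br]
    nlinarith
  | @cons q A B z g hz h hB ih =>
    have e : (val s y)⁻¹ * (val s z * g) * val s y =
      val s z * (val s (Tr.br z y) * ((val s y)⁻¹ * g * val s y)) := by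
      simp only [val]; group
    rw [e]
    refine .cons hz (.cons (hT z hz y) ih le_rfl) ?_
    rw [cs_br]
    nlinarith

theorem Adm.conj {T : Set (Tr k)} {t : Tr k} (hT : ∀ z ∈ T, ∀ y, Tr.br z y ∈ T)
    (ht : ∀ y, Tr.br t y ∈ T) {T' : Set (Tr k)} {n q : ℕ}
    {A B : ℝ} {g y : G} (hy : Cost s T' n B y) (hg : Adm s T t n q A g) :
    Adm s T t n q (A * Real.exp B) (y⁻¹ * g * y) := by
  have hA := hg.nonneg
  induction hy generalizing g A with
  | one hB => simpa using hg.mono (by nlinarith [Real.one_le_exp hB])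
  | @cons B B' z y hz h hB ih =>
    have := ih (hg.conjL hT ht z) (hg.conjL hT ht z).nonneg
    have e : (val s z * y)⁻¹ * g * (val s z * y) = y⁻¹ * ((val s z)⁻¹ * g * val s z) * y := by group
    rw [e]
    refine this.mono ?_
    have h1 : 1 + cs n z ≤ Real.exp (cs n z) := by linarith [Real.add_one_le_exp (cs n z)]
    calc A * (1 + cs n z) * Real.exp B ≤ A * Real.exp (cs n z) * Real.exp B := by gcongr
      _ = A * Real.exp (cs n z + B) := by rw [Real.exp_add]; ring
      _ ≤ A * Real.exp B' := by gcongr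

theorem Adm.le {T : Set (Tr k)} {t : Tr k} {n q : ℕ} {A : ℝ} {g : G} (hg : Adm s T t n q A g) :
    q * cs n t ≤ A := by
  induction hg with
  | one hA => simpa using hA
  | hit h hB ih => push_cast; linarith
  | @cons _ _ _ z _ hz h hB ih => linarith [cs_nonneg n z]

theorem Adm.collect {T : Set (Tr k)} {t : Tr k} (hT : ∀ z ∈ T, ∀ y, Tr.br z y ∈ T)
    {n q : ℕ} {A : ℝ} {g : G} (hg : Adm s T t n q A g) :
    ∃ h : G, g = val s t ^ q * h ∧ Cost s T n (A * Real.exp A) h := by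
  suffices H : ∃ h : G, g = val s t ^ q * h ∧ Cost s T n (A * Real.exp (q * cs n t)) h by
    obtain ⟨h, h1, h2⟩ := H
    refine ⟨h, h1, h2.mono ?_⟩
    have := hg.le
    have := hg.nonneg
    gcongr
  have ht := cs_nonneg n t
  induction hg with
  | one hA => exact ⟨1, by simp, by simpa using Cost.one hA⟩
  | @hit q A B g h hB ih =>
    obtain ⟨h', h1, h2⟩ := ih
    refine ⟨h', by rw [h1, ← mul_assoc, pow_succ'], h2.mono ?_⟩
    have := h.nonneg
    have : (q : ℝ) ≤ (q + 1 : ℕ) := by push_cast; linarith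
    have hAB : A ≤ B := by linarith
    have hB0 : 0 ≤ B := by linarith
    gcongr
  | @cons q A B z g hz h hB ih =>
    obtain ⟨h', h1, h2⟩ := ih
    refine ⟨(val s t ^ q)⁻¹ * val s z * val s t ^ q * h', by rw [h1]; group, ?_⟩
    have hy : Cost s (Set.univ) n (q * cs n t) (val s t ^ q) :=
      (Cost.single (Set.mem_univ t)).pow q
    refine ((Cost.conj hT hy (Cost.single hz)).mul h2).mono ?_
    rw [← add_mul]
    gcongr

theorem Cost.toAdm {T : Set (Tr k)} {t : Tr k} {n : ℕ} {A : ℝ} {g : G} (h : Cost s T n A g) :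
    ∃ q, Adm s (T \ {t}) t n q A g := by
  induction h with
  | one hA => exact ⟨0, .one hA⟩
  | @cons A B z g hz h hB ih =>
    obtain ⟨q, hq⟩ := ih
    by_cases hzt : z = t
    · subst hzt; exact ⟨q + 1, .hit hq hB⟩
    · exact ⟨q, .cons ⟨hz, hzt⟩ hq hB⟩

/-- letters of weight at least `a` -/
abbrev Wge (k a : ℕ) : Set (Tr k) := {z | a ≤ wt z}

theorem Wge_closed (a : ℕ) : ∀ z ∈ Wge k a, ∀ y, Tr.br z y ∈ Wge k a := by
  intro z hz y
  simp only [Set.mem_ofPred_eq, wt] at *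
  omega

theorem Wge_br (t : Tr k) : ∀ y, Tr.br t y ∈ Wge k (wt t + 1) := by
  intro y
  have := wt_pos y
  simp only [Set.mem_ofPred_eq, wt] at *
  omega

theorem comm1 {a b n : ℕ} {σ : ℝ} {z : Tr k} (hz : a ≤ wt z) {Y : G} (hY : Cost s (Wge k b) n σ Y) :
    ∃ K : G, Y⁻¹ * val s z * Y = val s z * K ∧
      Cost s (Wge k (a + b)) n (cs n z * Real.exp σ) K := by
  suffices H : ∃ K : G, ∃ κ : ℝ, Y⁻¹ * val s z * Y = val s z * K ∧
      Cost s (Wge k (a + b)) n κ K ∧ κ + cs n z ≤ cs n z * Real.exp σ by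
    obtain ⟨K, κ, h1, h2, h3⟩ := H
    exact ⟨K, h1, h2.mono (by linarith [cs_nonneg n z])⟩
  have hcz := cs_nonneg n z
  -- induct from the right: use generalized statement
  suffices H : ∀ (K0 : G) (κ0 : ℝ), Cost s (Wge k (a + b)) n κ0 K0 →
      ∃ K : G, ∃ κ : ℝ, Y⁻¹ * (val s z * K0) * Y = val s z * K ∧
      Cost s (Wge k (a + b)) n κ K ∧ κ + cs n z ≤ (κ0 + cs n z) * Real.exp σ by
    simpa using H 1 0 (.one le_rfl)
  induction hY with
  | one hA =>
    intro K0 κ0 h0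
    refine ⟨K0, κ0, by simp, h0, ?_⟩
    have := h0.nonneg
    nlinarith [Real.one_le_exp hA]
  | @cons A B y Y hy h hB ih =>
    intro K0 κ0 h0
    have hκ := h0.nonneg
    have hcy := cs_nonneg n y
    have hm : Tr.br z y ∈ Wge k (a + b) := by
      simp only [Set.mem_ofPred_eq, wt] at *; omega
    have h1 := (Cost.single (s := s) (n := n) hm).mul (h0.conjL (Wge_closed _) y)
    obtain ⟨K, κ, e1, e2, e3⟩ := ih _ _ h1
    refine ⟨K, κ, ?_, e2, e3.trans ?_⟩
    · rw [← e1]; simp only [val]; group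
    · rw [cs_br]
      have h1 : 1 + cs n y ≤ Real.exp (cs n y) := by linarith [Real.add_one_le_exp (cs n y)]
      calc (cs n z * cs n y + κ0 * (1 + cs n y) + cs n z) * Real.exp A
          = (κ0 + cs n z) * (1 + cs n y) * Real.exp A := by ring
        _ ≤ (κ0 + cs n z) * Real.exp (cs n y) * Real.exp A := by gcongr
        _ = (κ0 + cs n z) * Real.exp (cs n y + A) := by rw [Real.exp_add]; ring
        _ ≤ _ := by gcongr

theorem comm2 {a b n : ℕ} {σ ρ : ℝ} {u Y : G} (hu : Cost s (Wge k a) n ρ u)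
    (hY : Cost s (Wge k b) n σ Y) :
    ∃ K : G, Y⁻¹ * u * Y = u * K ∧
      Cost s (Wge k (a + b)) n (Real.exp σ * ρ * Real.exp ρ) K := by
  induction hu with
  | one hA => 
    refine ⟨1, by simp, .one (by positivity)⟩
  | @cons A B z u hz h hB ih =>
    obtain ⟨K, e1, e2⟩ := ih
    obtain ⟨L, f1, f2⟩ := comm1 hz hY
    refine ⟨u⁻¹ * L * u * K, ?_, ((Cost.conj (Wge_closed _) h f2).mul e2).mono ?_⟩
    · calc Y⁻¹ * (val s z * u) * Y = (Y⁻¹ * val s z * Y) * (Y⁻¹ * u * Y) := by group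
        _ = _ := by rw [e1, f1]; group
    · have hcz := cs_nonneg n z
      have hA := h.nonneg
      calc cs n z * Real.exp σ * Real.exp A + Real.exp σ * A * Real.exp A
          = Real.exp σ * (cs n z + A) * Real.exp A := by ring
        _ ≤ Real.exp σ * B * Real.exp B := by
          have hAB : A ≤ B := by linarith
          have hB0 : 0 ≤ B := by linarith
          gcongr

end
end NC

namespace NC
section
variable {G : Type*} [Group G] {k : ℕ} {s : Fin k → G}

theorem exists_word (hgen : Subgroup.closure (Set.range s) = ⊤) (g : G) :
    ∃ w : List G, (∀ x ∈ w, x ∈ symSet s) ∧ w.prod = g := by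
  have hg : g ∈ Subgroup.closure (Set.range s) := by rw [hgen]; trivial
  induction hg using Subgroup.closure_induction with
  | mem x hx =>
    obtain ⟨i, rfl⟩ := hx
    exact ⟨[s i], by simpa using ⟨i, Or.inl rfl⟩, by simp⟩
  | one => exact ⟨[], by simp, rfl⟩
  | mul x y _ _ hx hy =>
    obtain ⟨w, h1, h2⟩ := hx
    obtain ⟨v, h3, h4⟩ := hy
    refine ⟨w ++ v, ?_, by simp [h2, h4]⟩
    intro z hz
    rcases List.mem_append.1 hz with h | h
    · exact h1 z h
    · exact h3 z h
  | inv x _ hx =>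
    obtain ⟨w, h1, h2⟩ := hx
    refine ⟨(w.map (·⁻¹)).reverse, ?_, by rw [← List.prod_inv_reverse, h2]⟩
    intro z hz
    simp only [List.mem_reverse, List.mem_map] at hz
    obtain ⟨y, hy, rfl⟩ := hz
    obtain ⟨i, h | h⟩ := h1 y hy
    · exact ⟨i, Or.inr (by rw [h])⟩
    · exact ⟨i, Or.inl (by rw [h, inv_inv])⟩

theorem wordLen_spec (hgen : Subgroup.closure (Set.range s) = ⊤) (g : G) :
    ∃ w : List G, (∀ x ∈ w, x ∈ symSet s) ∧ w.length = wordLen (symSet s) g ∧ w.prod = g := by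
  obtain ⟨w, h1, h2⟩ := exists_word hgen g
  exact Nat.sInf_mem (s := {n | ∃ w : List G, (∀ x ∈ w, x ∈ symSet s) ∧ w.length = n ∧ w.prod = g})
    ⟨w.length, w, h1, rfl, h2⟩

theorem wordLen_le {S : Set G} {w : List G} (h : ∀ x ∈ w, x ∈ S) : wordLen S w.prod ≤ w.length :=
  Nat.sInf_le ⟨w, h, rfl, rfl⟩

theorem len_one : wordLen (symSet s) (1 : G) = 0 :=
  Nat.le_zero.1 (wordLen_le (w := []) (by simp))

theorem len_mul (hgen : Subgroup.closure (Set.range s) = ⊤) (g h : G) :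
    wordLen (symSet s) (g * h) ≤ wordLen (symSet s) g + wordLen (symSet s) h := by
  obtain ⟨w, h1, h2, h3⟩ := wordLen_spec hgen g
  obtain ⟨v, h4, h5, h6⟩ := wordLen_spec hgen h
  have := wordLen_le (S := symSet s) (w := w ++ v) (by
    intro z hz
    rcases List.mem_append.1 hz with h | h
    · exact h1 z h
    · exact h4 z h)
  simpa [h2, h3, h5, h6] using this

theorem len_inv_le (hgen : Subgroup.closure (Set.range s) = ⊤) (g : G) :
    wordLen (symSet s) g⁻¹ ≤ wordLen (symSet s) g := by
  obtain ⟨w, h1, h2, h3⟩ := wordLen_spec hgen g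
  have := wordLen_le (S := symSet s) (w := (w.map (·⁻¹)).reverse) (by
    intro z hz
    simp only [List.mem_reverse, List.mem_map] at hz
    obtain ⟨y, hy, rfl⟩ := hz
    obtain ⟨i, h | h⟩ := h1 y hy
    · exact ⟨i, Or.inr (by rw [h])⟩
    · exact ⟨i, Or.inl (by rw [h, inv_inv])⟩)
  rw [← List.prod_inv_reverse, h3] at this
  simpa [h2] using this

theorem len_inv (hgen : Subgroup.closure (Set.range s) = ⊤) (g : G) :
    wordLen (symSet s) g⁻¹ = wordLen (symSet s) g :=
  le_antisymm (len_inv_le hgen g) (by simpa using len_inv_le hgen g⁻¹)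

theorem len_pow (hgen : Subgroup.closure (Set.range s) = ⊤) (g : G) (m : ℕ) :
    wordLen (symSet s) (g ^ m) ≤ m * wordLen (symSet s) g := by
  induction m with
  | zero => simp [len_one]
  | succ m ih => rw [pow_succ, Nat.succ_mul]; exact (len_mul hgen _ _).trans (by omega)

theorem len_gen {x : G} (hx : x ∈ symSet s) : wordLen (symSet s) x ≤ 1 := by
  have := wordLen_le (S := symSet s) (w := [x]) (by simpa using hx)
  simpa using this

theorem cost_of_word {n : ℕ} (w : List G) (h : ∀ x ∈ w, x ∈ symSet s) :
    Cost s Set.univ n (w.length * (n : ℝ)⁻¹) w.prod := by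
  induction w with
  | nil => simpa using Cost.one le_rfl
  | cons x w ih =>
    have ih := ih (fun y hy => h y (List.mem_cons_of_mem _ hy))
    obtain ⟨i, hx⟩ := h x List.mem_cons_self
    have : ∃ b, x = val s (Tr.lf i b) := by
      rcases hx with hx | hx
      · exact ⟨true, by simp [val, hx]⟩
      · exact ⟨false, by simp [val, hx]⟩
    obtain ⟨b, rfl⟩ := this
    rw [List.prod_cons]
    refine .cons (Set.mem_univ _) ih ?_
    simp only [cs, wt, List.length_cons]
    push_cast
    rw [pow_one]
    linarith

theorem cost_of_len (hgen : Subgroup.closure (Set.range s) = ⊤) (n : ℕ) (g : G) :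
    Cost s Set.univ n (wordLen (symSet s) g * (n : ℝ)⁻¹) g := by
  obtain ⟨w, h1, h2, h3⟩ := wordLen_spec hgen g
  have := cost_of_word (n := n) w h1
  rwa [h2, h3] at this

theorem step1 (x y : Tr k) (n r : ℕ) :
    ∃ g : G, (val s y ^ r)⁻¹ * val s x * val s y ^ r = val s x * g ∧
      Adm s (Wge k (wt (Tr.br x y) + 1)) (Tr.br x y) n r
        (r * cs n (Tr.br x y) * Real.exp (r * cs n y)) g := by
  have ht := cs_nonneg n (Tr.br x y)
  have hy := cs_nonneg n y
  induction r with
  | zero => exact ⟨1, by simp, by simpa using Adm.one le_rfl⟩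
  | succ r ih =>
    obtain ⟨g, h1, h2⟩ := ih
    refine ⟨val s (Tr.br x y) * ((val s y)⁻¹ * g * val s y), ?_, ?_⟩
    · calc (val s y ^ (r + 1))⁻¹ * val s x * val s y ^ (r + 1)
          = (val s y)⁻¹ * ((val s y ^ r)⁻¹ * val s x * val s y ^ r) * val s y := by
            rw [pow_succ]; group
        _ = ((val s y)⁻¹ * val s x * val s y) * ((val s y)⁻¹ * g * val s y) := by rw [h1]; group
        _ = _ := by rw [conj_val]; group
    · refine .hit (h2.conjL (Wge_closed _) (Wge_br _) y) ?_
      have h1 : 1 + cs n y ≤ Real.exp (cs n y) := by linarith [Real.add_one_le_exp (cs n y)]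
      have e : Real.exp (((r + 1 : ℕ) : ℝ) * cs n y) = Real.exp (r * cs n y) * Real.exp (cs n y) := by
        rw [← Real.exp_add]; congr 1; push_cast; ring
      have h3 : 1 ≤ Real.exp (((r + 1 : ℕ) : ℝ) * cs n y) := Real.one_le_exp (by positivity)
      have h4 : (r * cs n (Tr.br x y) * Real.exp (r * cs n y)) * (1 + cs n y) ≤
        (r * cs n (Tr.br x y) * Real.exp (r * cs n y)) * Real.exp (cs n y) := by gcongr
      calc _ ≤ cs n (Tr.br x y) * Real.exp (((r + 1 : ℕ) : ℝ) * cs n y) +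
            (r * cs n (Tr.br x y) * Real.exp (r * cs n y)) * Real.exp (cs n y) := by
              gcongr; exact le_mul_of_one_le_right ht h3
        _ = _ := by rw [e]; push_cast; ring

theorem step2 (x t : Tr k) {n r : ℕ} {ρ : ℝ} {g : G}
    (hg : Adm s (Wge k (wt t + 1)) t n r ρ g) (p : ℕ) :
    ∃ K : G, (val s x * g) ^ p = val s x ^ p * K ∧
      Adm s (Wge k (wt t + 1)) t n (p * r) (p * ρ * Real.exp (p * cs n x)) K := by
  have hx := cs_nonneg n x
  have hρ := hg.nonneg
  induction p with
  | zero => exact ⟨1, by simp, by simpa using Adm.one le_rfl⟩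
  | succ p ih =>
    obtain ⟨K, h1, h2⟩ := ih
    refine ⟨(val s x)⁻¹ * K * val s x * g, ?_, ?_⟩
    · rw [pow_succ, h1, pow_succ]; group
    · rw [Nat.succ_mul]
      refine ((h2.conjL (Wge_closed _) (Wge_br _) x).mul hg).mono ?_
      have h1 : 1 + cs n x ≤ Real.exp (cs n x) := by linarith [Real.add_one_le_exp (cs n x)]
      have e : Real.exp (((p + 1 : ℕ) : ℝ) * cs n x) = Real.exp (p * cs n x) * Real.exp (cs n x) := by
        rw [← Real.exp_add]; congr 1; push_cast; ring
      have h3 : 1 ≤ Real.exp (((p + 1 : ℕ) : ℝ) * cs n x) := Real.one_le_exp (by positivity)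
      calc _ ≤ (p * ρ * Real.exp (p * cs n x)) * Real.exp (cs n x) +
            ρ * Real.exp (((p + 1 : ℕ) : ℝ) * cs n x) := by
              gcongr; exact le_mul_of_one_le_right hρ h3
        _ = _ := by rw [e]; push_cast; ring

theorem core (x y : Tr k) (Cx Cy : ℝ) (hCx : 0 ≤ Cx) (hCy : 0 ≤ Cy) :
    ∃ D : ℝ, 0 ≤ D ∧ ∀ (n p r : ℕ) (X Y : G),
      Adm s (Wge k (wt x + 1)) x n p Cx X → Adm s (Wge k (wt y + 1)) y n r Cy Y →
      Adm s (Wge k (wt (Tr.br x y) + 1)) (Tr.br x y) n (p * r) D (X⁻¹ * Y⁻¹ * X * Y) := by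
  obtain ⟨U, hU⟩ : ∃ U, U = Cx * Real.exp Cx := ⟨_, rfl⟩
  obtain ⟨V, hV⟩ : ∃ V, V = Cy * Real.exp Cy := ⟨_, rfl⟩
  have hU0 : 0 ≤ U := by rw [hU]; positivity
  have hV0 : 0 ≤ V := by rw [hV]; positivity
  refine ⟨(Real.exp V * Cx * Real.exp Cx + Cx * Cy * Real.exp Cy * Real.exp Cx * Real.exp V) *
    Real.exp U + Real.exp (Cy + V) * U * Real.exp U, by positivity, ?_⟩
  intro n p r X Y hX hY
  have hx := cs_nonneg n x
  have hy := cs_nonneg n y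
  have hp := hX.le
  have hr := hY.le
  obtain ⟨u, rfl, hu⟩ := hX.collect (Wge_closed _)
  obtain ⟨v, rfl, hv⟩ := hY.collect (Wge_closed _)
  rw [← hU] at hu
  rw [← hV] at hv
  obtain ⟨g, hg1, hg2⟩ := step1 (s := s) x y n r
  obtain ⟨K, hK1, hK2⟩ := step2 x (Tr.br x y) hg2 p
  have hK3 := hK2.mono (B := Cx * Cy * Real.exp Cy * Real.exp Cx) (by
    rw [cs_br]
    calc _ = (p * cs n x) * (r * cs n y) * Real.exp (r * cs n y) * Real.exp (p * cs n x) := by ring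
      _ ≤ _ := by gcongr)
  have hxp : Cost s (Wge k (wt x)) n Cx (val s x ^ p) :=
    ((Cost.single (by simp)).pow p).mono hp
  have hyr : Cost s (Wge k (wt y)) n Cy (val s y ^ r) :=
    ((Cost.single (by simp)).pow r).mono hr
  obtain ⟨k3, e3, h3⟩ := comm2 hxp hv
  have hYc := hyr.mul (hv.monoT (T' := Wge k (wt y)) (fun z hz => by
    simp only [Set.mem_ofPred_eq] at *; omega))
  obtain ⟨k1, e1, h1⟩ := comm2 hu hYc
  have hE : Wge k (wt x + 1 + wt y) = Wge k (wt (Tr.br x y) + 1) := by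
    simp only [wt]; congr 1; omega
  have hE' : Wge k (wt x + (wt y + 1)) = Wge k (wt (Tr.br x y) + 1) := by
    simp only [wt]; congr 1
  rw [hE] at h1
  rw [hE'] at h3
  have hKv := Adm.conj (Wge_closed _) (Wge_br _) hv hK3
  have hA := (Adm.conj (Wge_closed _) (Wge_br _) hu
    ((Adm.ofCost (t := Tr.br x y) h3).mul hKv)).mul (Adm.ofCost (t := Tr.br x y) h1)
  rw [zero_add, add_zero] at hA
  have eK : (val s y ^ r)⁻¹ * val s x ^ p * val s y ^ r = val s x ^ p * K := by
    rw [← hK1, ← hg1]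
    have := conj_pow (a := (val s y ^ r)⁻¹) (b := val s x) (i := p)
    rw [inv_inv] at this
    exact this.symm
  have key : (val s x ^ p * u)⁻¹ * (val s y ^ r * v)⁻¹ * (val s x ^ p * u) * (val s y ^ r * v)
      = u⁻¹ * (k3 * (v⁻¹ * K * v)) * u * k1 := by
    calc _ = u⁻¹ * (val s x ^ p)⁻¹ * (v⁻¹ * ((val s y ^ r)⁻¹ * val s x ^ p * val s y ^ r) * v) *
          ((val s y ^ r * v)⁻¹ * u * (val s y ^ r * v)) := by group
      _ = u⁻¹ * (val s x ^ p)⁻¹ * (v⁻¹ * val s x ^ p * v) * (v⁻¹ * K * v) * (u * k1) := by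
          rw [eK, e1]; group
      _ = _ := by rw [e3]; group
  rw [key]
  exact hA

theorem dist (hgen : Subgroup.closure (Set.range s) = ⊤) (t : Tr k) :
    ∃ C : ℝ, 0 ≤ C ∧ ∀ n : ℕ, 1 ≤ n → ∀ q ≤ n ^ wt t, ∃ g : G,
      (wordLen (symSet s) g : ℝ) ≤ C * n ∧ Adm s (Wge k (wt t + 1)) t n q C g := by
  induction t with
  | lf i b =>
    refine ⟨1, zero_le_one, fun n hn q hq => ⟨val s (Tr.lf i b) ^ q, ?_, ?_⟩⟩
    · have h1 : wordLen (symSet s) (val s (Tr.lf i b)) ≤ 1 := by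
        apply len_gen
        cases b
        · exact ⟨i, Or.inr (by simp [val])⟩
        · exact ⟨i, Or.inl (by simp [val])⟩
      have h2 := len_pow hgen (val s (Tr.lf i b)) q
      simp only [wt, pow_one] at hq
      rw [one_mul]
      exact_mod_cast h2.trans ((Nat.mul_le_mul_left q h1).trans (by omega))
    · have := (Adm.single (s := s) (T := Wge k (wt (Tr.lf i b) + 1)) (t := Tr.lf i b) (n := n)).pow q
      rw [mul_one] at this
      refine this.mono ?_
      have h0 : (0 : ℝ) < (n : ℝ) ^ wt (Tr.lf i b) := by positivity
      rw [cs, ← div_eq_mul_inv, div_le_one h0]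
      exact_mod_cast hq
  | br x y hx hy =>
    obtain ⟨Cx, hCx, hx⟩ := hx
    obtain ⟨Cy, hCy, hy⟩ := hy
    obtain ⟨D, hD, hcore⟩ := core (s := s) x y Cx Cy hCx hCy
    have main : ∀ n : ℕ, 1 ≤ n → ∀ p ≤ n ^ wt x, ∀ r ≤ n ^ wt y, ∃ g : G,
        (wordLen (symSet s) g : ℝ) ≤ 2 * (Cx + Cy) * n ∧
        Adm s (Wge k (wt (Tr.br x y) + 1)) (Tr.br x y) n (p * r) D g := by
      intro n hn p hp r hr
      obtain ⟨X, hX1, hX2⟩ := hx n hn p hp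
      obtain ⟨Y, hY1, hY2⟩ := hy n hn r hr
      refine ⟨_, ?_, hcore n p r X Y hX2 hY2⟩
      have h1 := len_mul hgen (X⁻¹ * Y⁻¹ * X) Y
      have h2 := len_mul hgen (X⁻¹ * Y⁻¹) X
      have h3 := len_mul hgen (X⁻¹) Y⁻¹
      rw [len_inv hgen, len_inv hgen] at h3
      have h4 : wordLen (symSet s) (X⁻¹ * Y⁻¹ * X * Y) ≤
        2 * wordLen (symSet s) X + 2 * wordLen (symSet s) Y := by omega
      have h5 : (wordLen (symSet s) (X⁻¹ * Y⁻¹ * X * Y) : ℝ) ≤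
        2 * wordLen (symSet s) X + 2 * wordLen (symSet s) Y := by exact_mod_cast h4
      linarith
    refine ⟨4 * (Cx + Cy) + 2 * D, by positivity, fun n hn q hq => ?_⟩
    simp only [wt, pow_add] at hq
    have hR : 0 < n ^ wt y := by positivity
    have hP : 1 ≤ n ^ wt x := Nat.one_le_pow _ _ hn
    obtain ⟨g1, a1, b1⟩ := main n hn (q / n ^ wt y)
      (Nat.div_le_of_le_mul (by rwa [mul_comm] at hq)) (n ^ wt y) le_rfl
    obtain ⟨g2, a2, b2⟩ := main n hn 1 hP (q % n ^ wt y) (Nat.mod_lt _ hR).le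
    refine ⟨g1 * g2, ?_, ?_⟩
    · have h1 : (wordLen (symSet s) (g1 * g2) : ℝ) ≤
        wordLen (symSet s) g1 + wordLen (symSet s) g2 := by exact_mod_cast len_mul hgen g1 g2
      have : 0 ≤ 2 * D * n := by positivity
      linarith
    · have := b1.mul b2
      rw [one_mul, Nat.div_add_mod'] at this
      exact this.mono (by linarith)

def Up (T : Set (Tr k)) : Prop := ∀ z ∈ T, ∀ y, wt z < wt y → y ∈ T

theorem Up.closed {T : Set (Tr k)} (h : Up T) : ∀ z ∈ T, ∀ y, Tr.br z y ∈ T := by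
  intro z hz y
  have := wt_pos y
  exact h z hz _ (by simp only [wt]; omega)

theorem up_induction (W : ℕ) (P : Set (Tr k) → Prop)
    (base : ∀ T, (∀ z ∈ T, W < wt z) → P T)
    (step : ∀ T t, t ∈ T → Up T → Up (T \ {t}) → Wge k (wt t + 1) ⊆ T \ {t} → P (T \ {t}) → P T) :
    P Set.univ := by
  suffices H : ∀ m : ℕ, ∀ T : Set (Tr k), Up T → (T ∩ {z | wt z ≤ W}).ncard = m → P T from
    H _ Set.univ (fun _ _ _ _ => Set.mem_univ _) rfl
  intro m
  induction m with
  | zero =>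
    intro T hT h0
    have hfin : (T ∩ {z | wt z ≤ W}).Finite := (finite_wt k W).subset Set.inter_subset_right
    rw [Set.ncard_eq_zero hfin] at h0
    refine base T fun z hz => ?_
    by_contra hc
    have : z ∈ T ∩ {z | wt z ≤ W} := ⟨hz, not_lt.1 hc⟩
    rw [h0] at this
    exact this
  | succ m ih =>
    intro T hT hm
    have hfin : (T ∩ {z | wt z ≤ W}).Finite := (finite_wt k W).subset Set.inter_subset_right
    have hne : (T ∩ {z | wt z ≤ W}).Nonempty := by
      rw [← Set.ncard_pos hfin]; omega
    obtain ⟨t, ht, hmin⟩ := Set.exists_min_image _ wt hfin hne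
    have hmin' : ∀ z ∈ T, wt t ≤ wt z := by
      intro z hz
      by_cases hzW : wt z ≤ W
      · exact hmin z ⟨hz, hzW⟩
      · have : wt t ≤ W := ht.2
        omega
    have hW : Wge k (wt t + 1) ⊆ T \ {t} := by
      intro z hz
      have hz' : wt t + 1 ≤ wt z := hz
      refine ⟨hT t ht.1 z (by omega), ?_⟩
      rintro rfl
      omega
    have hU : Up (T \ {t}) := by
      intro z hz y hy
      apply hW
      have := hmin' z hz.1
      show wt t + 1 ≤ wt y
      omega
    refine step T t ht.1 hT hU hW (ih _ hU ?_)
    have e : (T \ {t}) ∩ {z | wt z ≤ W} = (T ∩ {z | wt z ≤ W}) \ {t} := by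
      ext z; simp only [Set.mem_inter_iff, Set.mem_diff]; tauto
    rw [e, Set.ncard_diff_singleton_of_mem ht, hm]
    rfl

theorem cost_triv {W : ℕ} (hW : ∀ z : Tr k, W < wt z → val s z = 1) {T : Set (Tr k)}
    (hT : ∀ z ∈ T, W < wt z) {n : ℕ} {A : ℝ} {g : G} (h : Cost s T n A g) : g = 1 := by
  induction h with
  | one hA => rfl
  | cons hz h hB ih => rw [ih, hW _ (hT _ hz), one_mul]

theorem len_of_cost (hgen : Subgroup.closure (Set.range s) = ⊤) {W : ℕ}
    (hW : ∀ z : Tr k, W < wt z → val s z = 1) :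
    ∀ A : ℝ, 0 ≤ A → ∃ C : ℝ, 0 ≤ C ∧ ∀ n : ℕ, 1 ≤ n → ∀ g : G, Cost s Set.univ n A g →
      (wordLen (symSet s) g : ℝ) ≤ C * n := by
  refine up_induction W (fun T => ∀ A : ℝ, 0 ≤ A → ∃ C : ℝ, 0 ≤ C ∧ ∀ n : ℕ, 1 ≤ n →
    ∀ g : G, Cost s T n A g → (wordLen (symSet s) g : ℝ) ≤ C * n) ?_ ?_
  · intro T hT A hA
    refine ⟨0, le_rfl, fun n hn g hg => ?_⟩
    rw [cost_triv hW hT hg, len_one]; simp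
  · intro T t ht hUT hU hsub ih A hA
    obtain ⟨Ct, hCt, hdist⟩ := dist hgen t
    obtain ⟨E, hE⟩ : ∃ E, E = (A + 1) * Ct := ⟨_, rfl⟩
    have hE0 : 0 ≤ E := by rw [hE]; positivity
    obtain ⟨C', hC', ih⟩ := ih (E * Real.exp E + A * Real.exp A) (by positivity)
    refine ⟨E + C', by positivity, fun n hn g hg => ?_⟩
    obtain ⟨q, hq⟩ := hg.toAdm (t := t)
    have hqle := hq.le
    obtain ⟨h, rfl, hh⟩ := hq.collect hU.closed
    have hN : 0 < n ^ wt t := by positivity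
    have hNr : (0 : ℝ) < (n : ℝ) ^ wt t := by positivity
    rw [cs, ← div_eq_mul_inv, div_le_iff₀ hNr] at hqle
    have ha : ((q / n ^ wt t : ℕ) : ℝ) ≤ A := by
      have h1 : ((q / n ^ wt t : ℕ) : ℝ) ≤ (q : ℝ) / ((n ^ wt t : ℕ) : ℝ) := Nat.cast_div_le
      refine h1.trans ?_
      rw [div_le_iff₀ (by exact_mod_cast hN)]
      push_cast
      exact hqle
    obtain ⟨g1, a1, b1⟩ := hdist n hn _ le_rfl
    obtain ⟨g2, a2, b2⟩ := hdist n hn (q % n ^ wt t) (Nat.mod_lt _ hN).le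
    have b := (b1.pow (q / n ^ wt t)).mul b2
    rw [Nat.div_add_mod'] at b
    have hbE : ((q / n ^ wt t : ℕ) : ℝ) * Ct + Ct ≤ E := by
      rw [hE]; nlinarith
    obtain ⟨h', e', hh'⟩ := (b.mono hbE).collect (Wge_closed _)
    have hinv : Cost s (Wge k (wt t + 1)) n (E * Real.exp E) h'⁻¹ :=
      hh'.inv (by intro z hz; simpa only [Set.mem_ofPred_eq, wt_iv] using hz)
    have hfin := ih n hn _ ((hinv.monoT hsub).mul hh)
    have hlen : (wordLen (symSet s) (g1 ^ (q / n ^ wt t) * g2) : ℝ) ≤ E * n := by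
      have h1 := len_mul hgen (g1 ^ (q / n ^ wt t)) g2
      have h2 := len_pow hgen g1 (q / n ^ wt t)
      have h3 : (wordLen (symSet s) (g1 ^ (q / n ^ wt t) * g2) : ℝ) ≤
        ((q / n ^ wt t : ℕ) : ℝ) * wordLen (symSet s) g1 + wordLen (symSet s) g2 := by
        exact_mod_cast h1.trans (by omega)
      calc _ ≤ _ := h3
        _ ≤ ((q / n ^ wt t : ℕ) : ℝ) * (Ct * n) + Ct * n := by gcongr
        _ = (((q / n ^ wt t : ℕ) : ℝ) * Ct + Ct) * n := by ring
        _ ≤ _ := by gcongr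
    have e : val s t ^ q * h = (g1 ^ (q / n ^ wt t) * g2) * (h'⁻¹ * h) := by
      rw [e']; group
    rw [e]
    have h1 : (wordLen (symSet s) ((g1 ^ (q / n ^ wt t) * g2) * (h'⁻¹ * h)) : ℝ) ≤
      wordLen (symSet s) (g1 ^ (q / n ^ wt t) * g2) + wordLen (symSet s) (h'⁻¹ * h) := by
      exact_mod_cast len_mul hgen _ _
    linarith

theorem cover {W : ℕ} (hW : ∀ z : Tr k, W < wt z → val s z = 1) :
    ∀ A ε : ℝ, 0 ≤ A → 0 < ε → ∃ (K : ℕ) (A' : ℝ), 0 ≤ A' ∧ ∀ n : ℕ, 1 ≤ n →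
      ∃ X : Finset G, X.card ≤ K ∧ (∀ x ∈ X, Cost s Set.univ n A' x) ∧
      ∀ g, Cost s Set.univ n A g → ∃ x ∈ X, Cost s Set.univ n ε (x⁻¹ * g) := by
  refine up_induction W (fun T => ∀ A ε : ℝ, 0 ≤ A → 0 < ε → ∃ (K : ℕ) (A' : ℝ), 0 ≤ A' ∧
      ∀ n : ℕ, 1 ≤ n → ∃ X : Finset G, X.card ≤ K ∧ (∀ x ∈ X, Cost s Set.univ n A' x) ∧
      ∀ g, Cost s T n A g → ∃ x ∈ X, Cost s T n ε (x⁻¹ * g)) ?_ ?_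
  · intro T hT A ε hA hε
    refine ⟨1, 0, le_rfl, fun n hn => ⟨{1}, by simp, ?_, ?_⟩⟩
    · intro x hx
      rw [Finset.mem_singleton.1 hx]; exact .one le_rfl
    · intro g hg
      refine ⟨1, by simp, ?_⟩
      rw [cost_triv hW hT hg]; simpa using Cost.one hε.le
  · intro T t ht hUT hU hsub ih A ε hA hε
    obtain ⟨K1, A1, hA1, ih⟩ := ih (A * Real.exp A) (ε / 2) (by positivity) (by positivity)
    obtain ⟨δ, hδ⟩ : ∃ δ, δ = ε / 2 * (Real.exp A1)⁻¹ := ⟨_, rfl⟩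
    have hδ0 : 0 < δ := by rw [hδ]; positivity
    refine ⟨(⌊A / δ⌋₊ + 1) * K1, ⌊A / δ⌋₊ * (δ + 1) + A1, by positivity, fun n hn => ?_⟩
    obtain ⟨X1, hcard, hX1, hcov⟩ := ih n hn
    obtain ⟨M, hM⟩ : ∃ M, M = ⌊δ * (n : ℝ) ^ wt t⌋₊ + 1 := ⟨_, rfl⟩
    have hNr : (1 : ℝ) ≤ (n : ℝ) ^ wt t := one_le_pow₀ (by exact_mod_cast hn)
    have hM1 : (M : ℝ) ≤ (δ + 1) * (n : ℝ) ^ wt t := by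
      rw [hM]; push_cast
      have := Nat.floor_le (show 0 ≤ δ * (n : ℝ) ^ wt t by positivity)
      nlinarith
    have hM2 : δ * (n : ℝ) ^ wt t ≤ M := by
      rw [hM]; push_cast; exact (Nat.lt_floor_add_one _).le
    refine ⟨((Finset.range (⌊A / δ⌋₊ + 1)) ×ˢ X1).image (fun p => val s t ^ (p.1 * M) * p.2),
      ?_, ?_, ?_⟩
    · refine Finset.card_image_le.trans ?_
      rw [Finset.card_product, Finset.card_range]
      exact Nat.mul_le_mul_left _ hcard
    · intro x hx
      obtain ⟨⟨j, y⟩, hp, rfl⟩ := Finset.mem_image.1 hx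
      obtain ⟨hj, hy⟩ := Finset.mem_product.1 hp
      have hj : j ≤ ⌊A / δ⌋₊ := by have := Finset.mem_range.1 hj; dsimp only at this; omega
      refine (((Cost.single (Set.mem_univ t)).pow (j * M)).mul (hX1 y hy)).mono ?_
      have : ((j * M : ℕ) : ℝ) * cs n t ≤ ⌊A / δ⌋₊ * (δ + 1) := by
        rw [cs, ← div_eq_mul_inv, div_le_iff₀ (by linarith)]
        push_cast
        rw [mul_assoc]
        gcongr
      linarith
    · intro g hg
      obtain ⟨a, ha⟩ := hg.toAdm (t := t)
      have hale := ha.le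
      obtain ⟨h, rfl, hh⟩ := ha.collect hU.closed
      rw [cs, ← div_eq_mul_inv, div_le_iff₀ (by linarith)] at hale
      obtain ⟨x, hx, hxc⟩ := hcov h hh
      have hMpos : 0 < M := by omega
      have hjM : a / M * M ≤ a := Nat.div_mul_le_self a M
      have hjQ : a / M ≤ ⌊A / δ⌋₊ := by
        apply Nat.le_floor
        rw [le_div_iff₀ hδ0]
        have h1 : ((a / M : ℕ) : ℝ) * M ≤ a := by exact_mod_cast hjM
        have h2 : ((a / M : ℕ) : ℝ) * (δ * (n : ℝ) ^ wt t) ≤ A * (n : ℝ) ^ wt t :=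
          le_trans (le_trans (by gcongr) h1) hale
        rw [← mul_assoc] at h2
        exact le_of_mul_le_mul_right h2 (by linarith)
      refine ⟨val s t ^ (a / M * M) * x, Finset.mem_image.2 ⟨(a / M, x), ?_, rfl⟩, ?_⟩
      · exact Finset.mem_product.2 ⟨Finset.mem_range.2 (by dsimp only; omega), hx⟩
      · have e : (val s t ^ (a / M * M) * x)⁻¹ * (val s t ^ a * h) =
          (x⁻¹ * val s t ^ (a % M) * x) * (x⁻¹ * h) := by
          conv_lhs => rw [← Nat.div_add_mod' a M, pow_add]
          rw [Nat.div_add_mod' a M]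
          group
        rw [e]
        have h1 := (Cost.single (s := s) (n := n) ht).pow (a % M)
        refine ((Cost.conj hUT.closed (hX1 x hx) h1).mul (hxc.monoT Set.diff_subset)).mono ?_
        have hr : ((a % M : ℕ) : ℝ) ≤ δ * (n : ℝ) ^ wt t := by
          have h3 : a % M ≤ ⌊δ * (n : ℝ) ^ wt t⌋₊ := by
            have := Nat.mod_lt a hMpos; omega
          exact (Nat.cast_le.2 h3).trans (Nat.floor_le (by positivity))
        have h4 : ((a % M : ℕ) : ℝ) * cs n t ≤ δ := by
          rw [cs, ← div_eq_mul_inv, div_le_iff₀ (by linarith)]; exact hr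
        have h5 : ((a % M : ℕ) : ℝ) * cs n t * Real.exp A1 ≤ ε / 2 := by
          calc _ ≤ δ * Real.exp A1 := by gcongr
            _ = ε / 2 := by rw [hδ]; field_simp
        linarith

end
end NC

namespace NC
section
variable {G : Type*} [Group G] {k : ℕ} {s : Fin k → G}

theorem symSet_finite (s : Fin k → G) : (symSet s).Finite := by
  have : symSet s ⊆ Set.range s ∪ Set.range (fun i => (s i)⁻¹) := by
    rintro x ⟨i, h | h⟩
    · exact Or.inl ⟨i, h.symm⟩
    · exact Or.inr ⟨i, h.symm⟩
  exact ((Set.finite_range _).union (Set.finite_range _)).subset this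

theorem ball_finite (hgen : Subgroup.closure (Set.range s) = ⊤) (n : ℕ) :
    {g : G | wordLen (symSet s) g ≤ n}.Finite := by
  induction n with
  | zero =>
    refine (Set.finite_singleton (1 : G)).subset ?_
    intro g hg
    obtain ⟨w, h1, h2, h3⟩ := wordLen_spec hgen g
    have hg' : wordLen (symSet s) g ≤ 0 := hg
    have : w = [] := List.length_eq_zero_iff.1 (by omega)
    subst this
    simpa using h3.symm
  | succ n ih =>
    refine ((Set.finite_singleton (1 : G)).union
      (Set.Finite.image2 (fun a b => a * b) (symSet_finite s) ih)).subset ?_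
    intro g hg
    obtain ⟨w, h1, h2, h3⟩ := wordLen_spec hgen g
    have hg' : wordLen (symSet s) g ≤ n + 1 := hg
    cases w with
    | nil => left; simpa using h3.symm
    | cons x w =>
      right
      refine ⟨x, h1 x (by simp), w.prod, ?_, by simpa using h3⟩
      have := wordLen_le (S := symSet s) (w := w) (fun y hy => h1 y (by simp [hy]))
      simp only [List.length_cons] at h2
      simp only [Set.mem_ofPred_eq]
      omega

theorem vol_mono (hgen : Subgroup.closure (Set.range s) = ⊤) {m n : ℕ} (h : m ≤ n) :
    vol (symSet s) m ≤ vol (symSet s) n :=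
  Set.ncard_le_ncard (fun _ hg => le_trans hg h) (ball_finite hgen n)

theorem vol_pos (hgen : Subgroup.closure (Set.range s) = ⊤) (n : ℕ) :
    1 ≤ vol (symSet s) n := by
  have : (({g : G | wordLen (symSet s) g ≤ n}).ncard) ≠ 0 := by
    exact Set.ncard_ne_zero_of_mem (a := (1 : G)) (by simp [len_one]) (ball_finite hgen n)
  unfold vol; omega

theorem doubling [Group.IsNilpotent G] (hgen : Subgroup.closure (Set.range s) = ⊤) :
    ∃ K : ℕ, 1 ≤ K ∧ ∀ m : ℕ, vol (symSet s) (2 * m) ≤ K * vol (symSet s) m := by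
  obtain ⟨W, hW⟩ := exists_W s
  obtain ⟨C, hC0, hC⟩ := len_of_cost hgen hW 1 zero_le_one
  obtain ⟨C0, hC1, hCC⟩ : ∃ C0 : ℕ, 1 ≤ C0 ∧ C ≤ C0 :=
    ⟨⌈C⌉₊ + 1, by omega, by push_cast; linarith [Nat.le_ceil C]⟩
  obtain ⟨K, A', _, hK⟩ := cover (s := s) hW (4 * C0) 1 (by positivity) one_pos
  have key : ∀ n : ℕ, 1 ≤ n → vol (symSet s) (4 * C0 * n) ≤ K * vol (symSet s) (C0 * n) := by
    intro n hn
    obtain ⟨X, hX, _, hcov⟩ := hK n hn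
    have hn0 : (0 : ℝ) < n := by exact_mod_cast hn
    have hsub : {g : G | wordLen (symSet s) g ≤ 4 * C0 * n} ⊆
        ((X ×ˢ (ball_finite hgen (C0 * n)).toFinset).image (fun p => p.1 * p.2) : Finset G) := by
      intro g hg
      have hg' : wordLen (symSet s) g ≤ 4 * C0 * n := hg
      have hc := (cost_of_len hgen n g).mono (B := 4 * C0) (by
        rw [← div_eq_mul_inv, div_le_iff₀ hn0]; exact_mod_cast hg')
      obtain ⟨x, hx, hxg⟩ := hcov g hc
      have h1 := hC n hn _ hxg
      have h2 : (wordLen (symSet s) (x⁻¹ * g) : ℝ) ≤ (C0 * n : ℕ) := by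
        push_cast; exact h1.trans (by gcongr)
      have h3 : wordLen (symSet s) (x⁻¹ * g) ≤ C0 * n := by exact_mod_cast h2
      simp only [Finset.coe_image, Set.mem_image, Finset.mem_coe, Finset.mem_product,
        Set.Finite.mem_toFinset, Set.mem_ofPred_eq]
      exact ⟨(x, x⁻¹ * g), ⟨hx, h3⟩, by simp⟩
    calc vol (symSet s) (4 * C0 * n) ≤ _ := Set.ncard_le_ncard hsub (Finset.finite_toSet _)
      _ ≤ X.card * (ball_finite hgen (C0 * n)).toFinset.card := by
          rw [Set.ncard_coe_finset, ← Finset.card_product]; exact Finset.card_image_le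
      _ ≤ K * vol (symSet s) (C0 * n) := by
          unfold vol
          rw [Set.ncard_eq_toFinset_card _ (ball_finite hgen (C0 * n))]
          gcongr
  refine ⟨K + vol (symSet s) (2 * C0), by have := vol_pos hgen (2 * C0); omega, ?_⟩
  intro m
  rcases le_or_gt C0 m with h | h
  · have hn : 1 ≤ m / C0 := (Nat.one_le_div_iff (by omega)).2 h
    have h1 := Nat.div_add_mod m C0
    have h2 := Nat.mod_lt m (show C0 > 0 by omega)
    have h3 : C0 ≤ C0 * (m / C0) := Nat.le_mul_of_pos_right _ hn
    calc vol (symSet s) (2 * m) ≤ vol (symSet s) (4 * C0 * (m / C0)) :=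
          vol_mono hgen (by rw [mul_assoc]; omega)
      _ ≤ K * vol (symSet s) (C0 * (m / C0)) := key _ hn
      _ ≤ (K + vol (symSet s) (2 * C0)) * vol (symSet s) m := by
          gcongr
          · omega
          · exact vol_mono hgen (by omega)
  · calc vol (symSet s) (2 * m) ≤ vol (symSet s) (2 * C0) := vol_mono hgen (by omega)
      _ = vol (symSet s) (2 * C0) * 1 := by simp
      _ ≤ _ := by
          gcongr
          · omega
          · exact vol_pos hgen m

theorem exists_len [Infinite G] (hgen : Subgroup.closure (Set.range s) = ⊤) (n : ℕ) :
    ∃ g : G, wordLen (symSet s) g = n := by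
  obtain ⟨g, hg⟩ := (ball_finite hgen n).exists_notMem
  have hg' : n < wordLen (symSet s) g := by simpa using hg
  obtain ⟨w, h1, h2, h3⟩ := wordLen_spec hgen g
  refine ⟨(w.take n).prod, ?_⟩
  have ha := wordLen_le (S := symSet s) (w := w.take n) (fun x hx => h1 x (List.mem_of_mem_take hx))
  have hb := wordLen_le (S := symSet s) (w := w.drop n) (fun x hx => h1 x (List.mem_of_mem_drop hx))
  have hc := len_mul hgen (w.take n).prod (w.drop n).prod
  rw [List.prod_take_mul_prod_drop, h3] at hc
  rw [List.length_take] at ha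
  rw [List.length_drop] at hb
  omega

theorem growth [Infinite G] (hgen : Subgroup.closure (Set.range s) = ⊤) (n : ℕ) (hn : 1 ≤ n) :
    2 * vol (symSet s) n ≤ vol (symSet s) (4 * n) := by
  obtain ⟨g, hg⟩ := exists_len hgen (2 * n + 1)
  have hsub : {h : G | wordLen (symSet s) h ≤ n} ∪ (g * ·) '' {h : G | wordLen (symSet s) h ≤ n}
      ⊆ {h : G | wordLen (symSet s) h ≤ 4 * n} := by
    rintro h (hh | ⟨y, hy, rfl⟩)
    · have : wordLen (symSet s) h ≤ n := hh
      simp only [Set.mem_ofPred_eq]; omega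
    · have : wordLen (symSet s) y ≤ n := hy
      have := len_mul hgen g y
      simp only [Set.mem_ofPred_eq]; omega
  have hdis : Disjoint {h : G | wordLen (symSet s) h ≤ n}
      ((g * ·) '' {h : G | wordLen (symSet s) h ≤ n}) := by
    rw [Set.disjoint_left]
    rintro h hh ⟨y, hy, rfl⟩
    have h1 : wordLen (symSet s) (g * y) ≤ n := hh
    have h2 : wordLen (symSet s) y ≤ n := hy
    have h3 := len_mul hgen (g * y) y⁻¹
    rw [len_inv hgen, mul_inv_cancel_right] at h3
    omega
  have h1 := Set.ncard_le_ncard hsub (ball_finite hgen _)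
  rw [Set.ncard_union_eq hdis (ball_finite hgen _) ((ball_finite hgen _).image _),
    Set.ncard_image_of_injective _ (mul_right_injective g)] at h1
  unfold vol; omega

theorem growth_pow [Infinite G] (hgen : Subgroup.closure (Set.range s) = ⊤) (n : ℕ) (hn : 1 ≤ n)
    (j : ℕ) : 2 ^ j * vol (symSet s) n ≤ vol (symSet s) (4 ^ j * n) := by
  induction j with
  | zero => simp
  | succ j ih =>
    have := growth hgen (4 ^ j * n) (Nat.mul_pos (by positivity) hn)
    rw [show 4 ^ (j + 1) * n = 4 * (4 ^ j * n) by ring]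
    rw [show 2 ^ (j + 1) * vol (symSet s) n = 2 * (2 ^ j * vol (symSet s) n) by ring]
    omega

theorem growth_sqrt [Infinite G] (hgen : Subgroup.closure (Set.range s) = ⊤) (R m : ℕ) (hR : 1 ≤ R)
    (hm : R ≤ m) : Real.sqrt m * vol (symSet s) R ≤ 2 * Real.sqrt R * vol (symSet s) m := by
  set j := Nat.log 4 (m / R) with hj
  have hq : m / R ≠ 0 := by have := (Nat.one_le_div_iff (by omega)).2 hm; omega
  have h1 : 4 ^ j ≤ m / R := Nat.pow_log_le_self 4 hq
  have h2 : m / R < 4 ^ (j + 1) := Nat.lt_pow_succ_log_self (by norm_num) _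
  have h3 : 4 ^ j * R ≤ m := (Nat.mul_le_mul_right R h1).trans (Nat.div_mul_le_self m R)
  have h4 : m ≤ 4 ^ (j + 1) * R := ((Nat.div_lt_iff_lt_mul (by omega)).1 h2).le
  have h5 : Real.sqrt m ≤ 2 ^ (j + 1) * Real.sqrt R := by
    rw [show (2 : ℝ) ^ (j + 1) = Real.sqrt (4 ^ (j + 1)) by
      rw [show (4 : ℝ) = 2 ^ 2 by norm_num, ← pow_mul, mul_comm, pow_mul, Real.sqrt_sq (by positivity)],
      ← Real.sqrt_mul (by positivity)]
    apply Real.sqrt_le_sqrt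
    exact_mod_cast h4
  have h6 : (2 : ℝ) ^ j * vol (symSet s) R ≤ vol (symSet s) m := by
    exact_mod_cast (growth_pow hgen R hR j).trans (vol_mono hgen h3)
  calc Real.sqrt m * vol (symSet s) R ≤ 2 ^ (j + 1) * Real.sqrt R * vol (symSet s) R := by gcongr
    _ = 2 * Real.sqrt R * (2 ^ j * vol (symSet s) R) := by ring
    _ ≤ _ := by gcongr

theorem l_doubling {l : ℝ → ℝ} (hlpos : ∀ x, 0 ≤ x → 0 < l x) (hlmono : MonotoneOn l (Set.Ici 0))
    (hlsv : SlowlyVarying l) : ∃ K : ℝ, 1 ≤ K ∧ ∀ x, 0 ≤ x → l (4 * x) ≤ K * l x := by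
  have h := hlsv 4 (by norm_num)
  have h2 : ∀ᶠ x in atTop, l (4 * x) / l x < 2 := h.eventually_lt_const (by norm_num)
  obtain ⟨a, ha⟩ := eventually_atTop.1 h2
  set M := max a 0
  have hM0 : 0 ≤ M := le_max_right _ _
  have hl0 := hlpos 0 le_rfl
  have hlM := hlpos (4 * M) (by positivity)
  refine ⟨2 + l (4 * M) / l 0, by have := div_pos hlM hl0; linarith, ?_⟩
  intro x hx
  have hlx := hlpos x hx
  have hd := div_pos hlM hl0
  rcases le_or_gt M x with hxM | hxM
  · have := ha x ((le_max_left _ _).trans hxM)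
    rw [div_lt_iff₀ hlx] at this
    nlinarith [mul_pos hd hlx]
  · have e1 : l (4 * x) ≤ l (4 * M) := hlmono (by simp [hx]) (by simp [hM0]) (by linarith)
    have e2 : l 0 ≤ l x := hlmono (by simp) hx hx
    have e3 : l (4 * M) = l (4 * M) / l 0 * l 0 := by field_simp
    have e4 : l (4 * M) / l 0 * l 0 ≤ l (4 * M) / l 0 * l x := by gcongr
    nlinarith

end
end NC

namespace NC
section
open scoped ENNReal

theorem tele (m : ℕ) (hm : 1 ≤ m) :
    1 / ((m : ℝ) * Real.sqrt m) ≤ 4 / Real.sqrt m - 4 / Real.sqrt ((m + 1 : ℕ) : ℝ) := by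
  have hm0 : (1 : ℝ) ≤ m := by exact_mod_cast hm
  set a := Real.sqrt m with ha
  set b := Real.sqrt ((m + 1 : ℕ) : ℝ) with hb
  have ha2 : a ^ 2 = m := Real.sq_sqrt (by positivity)
  have hb2 : b ^ 2 = m + 1 := by rw [hb, Real.sq_sqrt (by positivity)]; push_cast; ring
  have ha0 : 0 < a := Real.sqrt_pos.2 (by positivity)
  have hb0 : 0 < b := Real.sqrt_pos.2 (by positivity)
  have hab : a ≤ b := Real.sqrt_le_sqrt (by push_cast; linarith)
  have hb15 : b ≤ 3 / 2 * a := by nlinarith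
  rw [← ha2, div_sub_div _ _ ha0.ne' hb0.ne', div_le_div_iff₀ (by positivity) (by positivity)]
  have h1 : (b - a) * (b + a) = 1 := by nlinarith
  have h2 : b * (b + a) ≤ 4 * a ^ 2 := by nlinarith
  have h3 : (0 : ℝ) ≤ b - a := by linarith
  have h4 : b * (b + a) * (b - a) ≤ 4 * a ^ 2 * (b - a) := by gcongr
  have h5 : b ≤ 4 * a ^ 2 * (b - a) := by nlinarith
  nlinarith

theorem tail32 (R : ℕ) (hR : 1 ≤ R) (n : ℕ) :
    ∑ m ∈ Finset.range n, (if R ≤ m then 1 / ((m : ℝ) * Real.sqrt m) else 0) ≤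
      4 / Real.sqrt R - 4 / Real.sqrt ((max n R : ℕ) : ℝ) := by
  induction n with
  | zero => simp
  | succ n ih =>
    rw [Finset.sum_range_succ]
    by_cases h : R ≤ n
    · rw [if_pos h]
      rw [max_eq_left h] at ih
      rw [max_eq_left (by omega)]
      have := tele n (by omega)
      linarith
    · rw [if_neg h]
      rw [max_eq_right (by omega)] at ih ⊢
      linarith

theorem sum_int_le (F : ℕ → ℝ≥0∞) : ∑' n : ℤ, F (1 + n.natAbs) ≤ 2 * ∑' m, F m := by
  rw [tsum_of_nat_of_neg_add_one (f := fun n : ℤ => F (1 + n.natAbs)) ENNReal.summable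
    ENNReal.summable, two_mul]
  refine add_le_add ?_ ?_
  · refine le_trans (le_of_eq ?_) (ENNReal.tsum_comp_le_tsum_of_injective
      (f := fun n : ℕ => 1 + n) (fun a b h => by simpa using h) F)
    simp
  · refine le_trans (le_of_eq ?_) (ENNReal.tsum_comp_le_tsum_of_injective
      (f := fun n : ℕ => 1 + (n + 1)) (fun a b h => by simpa using h) F)
    refine tsum_congr fun n => ?_
    congr 2

variable {G : Type*} [Group G] {k : ℕ} {s : Fin k → G}

theorem tailV [Infinite G] (hgen : Subgroup.closure (Set.range s) = ⊤) (R : ℕ) (hR : 1 ≤ R) :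
    ∑' m : ℕ, ENNReal.ofReal (if R ≤ m then 1 / ((m : ℝ) * vol (symSet s) m) else 0) ≤
      ENNReal.ofReal (8 / vol (symSet s) R) := by
  refine ENNReal.tsum_le_of_sum_range_le fun n => ?_
  rw [← ENNReal.ofReal_sum_of_nonneg (fun m _ => by split_ifs <;> positivity)]
  apply ENNReal.ofReal_le_ofReal
  have hV : ∀ m, (0 : ℝ) < vol (symSet s) m := fun m => by
    exact_mod_cast vol_pos hgen m
  have hR0 : 0 < Real.sqrt R := Real.sqrt_pos.2 (by exact_mod_cast hR)
  calc _ ≤ ∑ m ∈ Finset.range n, (2 * Real.sqrt R / vol (symSet s) R) *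
        (if R ≤ m then 1 / ((m : ℝ) * Real.sqrt m) else 0) := by
        apply Finset.sum_le_sum
        intro m _
        by_cases h : R ≤ m
        · rw [if_pos h, if_pos h]
          have hm : (0 : ℝ) < m := by exact_mod_cast (lt_of_lt_of_le hR h)
          have hm0 : 0 < Real.sqrt m := Real.sqrt_pos.2 hm
          have h1 := growth_sqrt hgen R m hR h
          have := hV m
          have := hV R
          rw [div_mul_div_comm, div_le_div_iff₀ (by positivity) (by positivity)]
          calc 1 * (↑(vol (symSet s) R) * (m * Real.sqrt m))
              = m * (Real.sqrt m * vol (symSet s) R) := by ring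
            _ ≤ m * (2 * Real.sqrt R * vol (symSet s) m) := by gcongr
            _ = _ := by ring
        · rw [if_neg h, if_neg h]; simp
    _ = (2 * Real.sqrt R / vol (symSet s) R) * ∑ m ∈ Finset.range n,
        (if R ≤ m then 1 / ((m : ℝ) * Real.sqrt m) else 0) := by rw [Finset.mul_sum]
    _ ≤ (2 * Real.sqrt R / vol (symSet s) R) * (4 / Real.sqrt R) := by
        gcongr
        refine (tail32 R hR n).trans ?_
        have : (0 : ℝ) ≤ 4 / Real.sqrt ((max n R : ℕ) : ℝ) := by positivity
        linarith
    _ = _ := by have := hV R; field_simp; norm_num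

/-- Weighted tail bound. -/
theorem tailW [Infinite G] [Group.IsNilpotent G] (hgen : Subgroup.closure (Set.range s) = ⊤)
    {l : ℝ → ℝ} (hlpos : ∀ x, 0 ≤ x → 0 < l x) (hlmono : MonotoneOn l (Set.Ici 0))
    (hlsv : SlowlyVarying l) :
    ∃ C : ℝ, 0 ≤ C ∧ ∀ r : ℕ,
      ∑' n : ℤ, ENNReal.ofReal (if r ≤ 2 * (1 + n.natAbs) then
        4 / (((1 + n.natAbs : ℕ) : ℝ) * l ((1 + n.natAbs : ℕ) : ℝ) *
          vol (symSet s) (1 + n.natAbs)) else 0) ≤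
      ENNReal.ofReal (C * (1 / ((vol (symSet s) (1 + r) : ℝ) * l (1 + (r : ℝ))))) := by
  obtain ⟨K, hK1, hK⟩ := doubling (s := s) hgen
  obtain ⟨L, hL1, hL⟩ := l_doubling hlpos hlmono hlsv
  have hV : ∀ m, (0 : ℝ) < vol (symSet s) m := fun m => by
    exact_mod_cast vol_pos hgen m
  refine ⟨2 * (4 * L * (8 * K ^ 2)), by positivity, ?_⟩
  intro r
  set R := max 1 ((r + 1) / 2) with hRdef
  have hR1 : 1 ≤ R := le_max_left _ _
  have hrR : r ≤ 2 * R := by omega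
  have hiff : ∀ m : ℕ, 1 ≤ m → r ≤ 2 * m → R ≤ m := by intro m h1 h2; omega
  have hlr := hlpos (1 + r) (by positivity)
  have hV4 : (vol (symSet s) (1 + r) : ℝ) ≤ K ^ 2 * vol (symSet s) R := by
    have h1 := vol_mono hgen (show 1 + r ≤ 2 * (2 * R) by omega)
    have h2 := hK (2 * R)
    have h3 := Nat.mul_le_mul_left K (hK R)
    have h4 := h1.trans (h2.trans h3)
    rw [← mul_assoc, ← pow_two] at h4
    exact_mod_cast h4
  have hstep := sum_int_le (fun m => ENNReal.ofReal (4 * L / l (1 + r)) *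
    ENNReal.ofReal (if R ≤ m then 1 / ((m : ℝ) * vol (symSet s) m) else 0))
  calc _ ≤ _ := ?_
    _ ≤ _ := hstep
    _ ≤ _ := ?_
  · refine ENNReal.tsum_le_tsum fun n => ?_
    rw [← ENNReal.ofReal_mul (by positivity)]
    apply ENNReal.ofReal_le_ofReal
    generalize hmm : 1 + n.natAbs = m
    have hm1 : 1 ≤ m := by omega
    split_ifs with h1 h2 h2
    · have hm0 : (0 : ℝ) < m := by exact_mod_cast hm1
      have hlm := hlpos m hm0.le
      have := hV m
      have e1 : l (1 + r) ≤ L * l m := by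
        refine le_trans (hlmono (by simp; positivity) (by simp) ?_) (hL m hm0.le)
        have : 1 + r ≤ 4 * m := by omega
        exact_mod_cast this
      rw [div_mul_div_comm, div_le_div_iff₀ (by positivity) (by positivity)]
      calc 4 * (l (1 + r) * (m * vol (symSet s) m)) ≤ 4 * (L * l m * (m * vol (symSet s) m)) := by
            gcongr
        _ = _ := by ring
    · exact absurd (hiff m hm1 h1) h2
    · positivity
    · simp
  · rw [ENNReal.tsum_mul_left]
    calc _ ≤ 2 * (ENNReal.ofReal (4 * L / l (1 + r)) * ENNReal.ofReal (8 / vol (symSet s) R)) := by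
          gcongr; exact tailV hgen R hR1
      _ = ENNReal.ofReal (2 * (4 * L / l (1 + r) * (8 / vol (symSet s) R))) := by
          rw [ENNReal.ofReal_mul (by norm_num), ENNReal.ofReal_mul (by positivity)]; simp
      _ ≤ _ := by
          apply ENNReal.ofReal_le_ofReal
          have := hV R
          have := hV (1 + r)
          have h9 : 8 / (vol (symSet s) R : ℝ) ≤ 8 * K ^ 2 / vol (symSet s) (1 + r) := by
            rw [div_le_div_iff₀ (by positivity) (by positivity)]; linarith
          calc _ ≤ 2 * (4 * L / l (1 + r) * (8 * K ^ 2 / vol (symSet s) (1 + r))) := by gcongr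
            _ = _ := by field_simp

/-- Squared translation norm. -/
def NN (f : G → ℝ) (y : G) : ℝ≥0∞ := ∑' x, ENNReal.ofReal (|f (x * y) - f x| ^ 2)

theorem NN_mul (f : G → ℝ) (y z : G) : NN f (y * z) ≤ 2 * NN f y + 2 * NN f z := by
  have hz : NN f z = ∑' x, ENNReal.ofReal (|f (x * y * z) - f (x * y)| ^ 2) :=
    ((Equiv.mulRight y).tsum_eq (fun x => ENNReal.ofReal (|f (x * z) - f x| ^ 2))).symm
  rw [hz]
  unfold NN
  rw [← ENNReal.tsum_mul_left, ← ENNReal.tsum_mul_left, ← ENNReal.tsum_add]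
  refine ENNReal.tsum_le_tsum fun x => ?_
  rw [show (2 : ℝ≥0∞) = ENNReal.ofReal 2 by simp, ← ENNReal.ofReal_mul (by norm_num),
    ← ENNReal.ofReal_mul (by norm_num), ← ENNReal.ofReal_add (by positivity) (by positivity)]
  apply ENNReal.ofReal_le_ofReal
  simp only [sq_abs, ← mul_assoc]
  nlinarith [sq_nonneg ((f (x * y) - f x) - (f (x * y * z) - f (x * y)))]

theorem NN_inv (f : G → ℝ) (y : G) : NN f y⁻¹ = NN f y := by
  unfold NN
  rw [← (Equiv.mulRight y).tsum_eq]
  refine tsum_congr fun x => ?_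
  simp [abs_sub_comm]

theorem NN_le (f : G → ℝ) (y : G) : NN f y ≤ 4 * ∑' x, ENNReal.ofReal (f x ^ 2) := by
  have h := (Equiv.mulRight y).tsum_eq (fun x => ENNReal.ofReal (f x ^ 2))
  calc NN f y ≤ ∑' x, (2 * ENNReal.ofReal (f (x * y) ^ 2) + 2 * ENNReal.ofReal (f x ^ 2)) := by
        refine ENNReal.tsum_le_tsum fun x => ?_
        rw [show (2 : ℝ≥0∞) = ENNReal.ofReal 2 by simp, ← ENNReal.ofReal_mul (by norm_num),
          ← ENNReal.ofReal_mul (by norm_num), ← ENNReal.ofReal_add (by positivity) (by positivity)]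
        apply ENNReal.ofReal_le_ofReal
        simp only [sq_abs]
        nlinarith [sq_nonneg (f (x * y) + f x)]
    _ = 2 * (∑' x, ENNReal.ofReal (f x ^ 2)) + 2 * ∑' x, ENNReal.ofReal (f x ^ 2) := by
        rw [ENNReal.tsum_add, ENNReal.tsum_mul_left, ENNReal.tsum_mul_left, ← h]; rfl
    _ = _ := by rw [← add_mul]; norm_num

theorem NN_avg (hgen : Subgroup.closure (Set.range s) = ⊤) (f : G → ℝ) (g : G) (m : ℕ)
    (hg : wordLen (symSet s) g ≤ m) :
    (vol (symSet s) m : ℝ≥0∞) * NN f g ≤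
      4 * ∑' y, if wordLen (symSet s) y ≤ 2 * m then NN f y else 0 := by
  set B := (ball_finite hgen m).toFinset with hB
  have hmem : ∀ y, y ∈ B ↔ wordLen (symSet s) y ≤ m := by intro y; simp [hB]
  have hcard : vol (symSet s) m = B.card := by
    unfold vol; rw [Set.ncard_eq_toFinset_card _ (ball_finite hgen m)]
  set T := ∑' y, if wordLen (symSet s) y ≤ 2 * m then NN f y else 0 with hT
  have h1 : ∑ y ∈ B, NN f y ≤ T := by
    refine le_trans (Finset.sum_le_sum fun y hy => ?_) (ENNReal.sum_le_tsum B)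
    rw [if_pos (by have := (hmem y).1 hy; omega)]
  have h2 : ∑ y ∈ B, NN f (y⁻¹ * g) ≤ T := by
    calc _ ≤ ∑ y ∈ B, (if wordLen (symSet s) (y⁻¹ * g) ≤ 2 * m then NN f (y⁻¹ * g) else 0) := by
          refine Finset.sum_le_sum fun y hy => ?_
          rw [if_pos]
          have a := (hmem y).1 hy
          have b := len_mul hgen y⁻¹ g
          rw [len_inv hgen] at b
          omega
      _ ≤ ∑' y, (if wordLen (symSet s) (y⁻¹ * g) ≤ 2 * m then NN f (y⁻¹ * g) else 0) :=
          ENNReal.sum_le_tsum B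
      _ ≤ T := ENNReal.tsum_comp_le_tsum_of_injective (f := fun y : G => y⁻¹ * g)
          (fun a b h => by simpa using h)
          (fun y => if wordLen (symSet s) y ≤ 2 * m then NN f y else 0)
  calc (vol (symSet s) m : ℝ≥0∞) * NN f g = ∑ y ∈ B, NN f g := by
        rw [hcard, Finset.sum_const, nsmul_eq_mul]
    _ ≤ ∑ y ∈ B, (2 * NN f y + 2 * NN f (y⁻¹ * g)) := by
        refine Finset.sum_le_sum fun y _ => ?_
        have := NN_mul f y (y⁻¹ * g)
        rwa [mul_inv_cancel_left] at this
    _ = 2 * ∑ y ∈ B, NN f y + 2 * ∑ y ∈ B, NN f (y⁻¹ * g) := by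
        rw [Finset.sum_add_distrib, Finset.mul_sum, Finset.mul_sum]
    _ ≤ 2 * T + 2 * T := by gcongr
    _ = 4 * T := by rw [← add_mul]; norm_num

theorem len_zpow (hgen : Subgroup.closure (Set.range s) = ⊤) (i : Fin k) (n : ℤ) :
    wordLen (symSet s) (s i ^ n) ≤ n.natAbs := by
  have h1 := len_gen (s := s) (x := s i) ⟨i, Or.inl rfl⟩
  have h2 := len_pow hgen (s i) n.natAbs
  have h3 : n.natAbs * wordLen (symSet s) (s i) ≤ n.natAbs * 1 := Nat.mul_le_mul_left _ h1
  rcases Int.natAbs_eq n with h | h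
  · rw [h, zpow_natCast, Int.natAbs_natCast]; omega
  · rw [h, zpow_neg, zpow_natCast, len_inv hgen, Int.natAbs_neg, Int.natAbs_natCast]; omega

theorem main_ineq [Infinite G] [Group.IsNilpotent G] (hgen : Subgroup.closure (Set.range s) = ⊤)
    {l : ℝ → ℝ} (hlpos : ∀ x, 0 ≤ x → 0 < l x) (hlmono : MonotoneOn l (Set.Ici 0))
    (hlsv : SlowlyVarying l) :
    ∃ C : ℝ, 0 ≤ C ∧ ∀ (f : G → ℝ) (i : Fin k),
      ∑' n : ℤ, NN f (s i ^ n) * ENNReal.ofReal (1 / ((1 + (|n| : ℝ)) * l (1 + (|n| : ℝ)))) ≤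
      ENNReal.ofReal C * ∑' y, NN f y *
        ENNReal.ofReal (1 / ((vol (symSet s) (1 + wordLen (symSet s) y) : ℝ) *
          l (1 + (wordLen (symSet s) y : ℝ)))) := by
  obtain ⟨C, hC, hmain⟩ := tailW (s := s) hgen hlpos hlmono hlsv
  refine ⟨C, hC, fun f i => ?_⟩
  have hV : ∀ m, (0 : ℝ) < vol (symSet s) m := fun m => by
    exact_mod_cast vol_pos hgen m
  calc _ ≤ ∑' n : ℤ, ∑' y, NN f y * ENNReal.ofReal (if wordLen (symSet s) y ≤ 2 * (1 + n.natAbs) then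
        4 / (((1 + n.natAbs : ℕ) : ℝ) * l ((1 + n.natAbs : ℕ) : ℝ) *
          vol (symSet s) (1 + n.natAbs)) else 0) := by
        refine ENNReal.tsum_le_tsum fun n => ?_
        have hcast : (1 + (|n| : ℝ)) = ((1 + n.natAbs : ℕ) : ℝ) := by
          push_cast; rw [Nat.cast_natAbs]; push_cast; ring
        rw [hcast]
        have hlen : wordLen (symSet s) (s i ^ n) ≤ 1 + n.natAbs :=
          (len_zpow hgen i n).trans (by omega)
        generalize hmm : 1 + n.natAbs = m at hlen ⊢
        have hm0 : (0 : ℝ) < m := by exact_mod_cast (show 0 < m by omega)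
        have hlm := hlpos m hm0.le
        have hVm := hV m
        have havg := NN_avg hgen f _ m hlen
        have e1 : ENNReal.ofReal (1 / (m * l m)) =
            (vol (symSet s) m : ℝ≥0∞) * ENNReal.ofReal (1 / (m * l m * vol (symSet s) m)) := by
          rw [← ENNReal.ofReal_natCast (vol (symSet s) m), ← ENNReal.ofReal_mul hVm.le]
          congr 1; field_simp
        have e2 : ENNReal.ofReal (4 / (m * l m * vol (symSet s) m)) =
            4 * ENNReal.ofReal (1 / (m * l m * vol (symSet s) m)) := by
          rw [show (4 : ℝ≥0∞) = ENNReal.ofReal 4 by simp, ← ENNReal.ofReal_mul (by norm_num)]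
          congr 1; ring
        calc _ = (vol (symSet s) m * NN f (s i ^ n)) *
              ENNReal.ofReal (1 / (m * l m * vol (symSet s) m)) := by rw [e1]; ring
          _ ≤ (4 * ∑' y, if wordLen (symSet s) y ≤ 2 * m then NN f y else 0) *
              ENNReal.ofReal (1 / (m * l m * vol (symSet s) m)) := by gcongr
          _ = ∑' y, (if wordLen (symSet s) y ≤ 2 * m then NN f y else 0) *
              ENNReal.ofReal (4 / (m * l m * vol (symSet s) m)) := by
                rw [ENNReal.tsum_mul_right, e2]; ring
          _ ≤ _ := by
                refine ENNReal.tsum_le_tsum fun y => ?_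
                split_ifs <;> simp
    _ = ∑' y, NN f y * ∑' n : ℤ, ENNReal.ofReal (if wordLen (symSet s) y ≤ 2 * (1 + n.natAbs) then
        4 / (((1 + n.natAbs : ℕ) : ℝ) * l ((1 + n.natAbs : ℕ) : ℝ) *
          vol (symSet s) (1 + n.natAbs)) else 0) := by
        rw [ENNReal.tsum_comm]
        refine tsum_congr fun y => ?_
        rw [ENNReal.tsum_mul_left]
    _ ≤ ∑' y, NN f y * ENNReal.ofReal (C * (1 / ((vol (symSet s) (1 + wordLen (symSet s) y) : ℝ) *
          l (1 + (wordLen (symSet s) y : ℝ))))) := by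
        refine ENNReal.tsum_le_tsum fun y => ?_
        gcongr
        exact hmain _
    _ = _ := by
        rw [← ENNReal.tsum_mul_left]
        refine tsum_congr fun y => ?_
        rw [ENNReal.ofReal_mul hC]; ring

end
end NC

namespace NC
section
open scoped ENNReal
variable {G : Type*} [Group G] {k : ℕ} {s : Fin k → G}

theorem dirichlet_eq (μ f : G → ℝ) (hμ : ∀ g, 0 ≤ μ g) :
    dirichlet μ f = 1 / 2 * (∑' y, NN f y * ENNReal.ofReal (μ y)).toReal := by
  unfold dirichlet
  congr 1
  have h1 : ∑' y, NN f y * ENNReal.ofReal (μ y) =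
      ∑' p : G × G, ENNReal.ofReal (|f (p.1 * p.2) - f p.1| ^ 2 * μ p.2) := by
    rw [ENNReal.tsum_prod', ENNReal.tsum_comm]
    refine tsum_congr fun y => ?_
    unfold NN
    rw [← ENNReal.tsum_mul_right]
    refine tsum_congr fun x => ?_
    rw [ENNReal.ofReal_mul (by positivity)]
  rw [h1, ENNReal.tsum_toReal_eq (fun _ => ENNReal.ofReal_ne_top)]
  refine tsum_congr fun p => ?_
  rw [ENNReal.toReal_ofReal (mul_nonneg (by positivity) (hμ _))]

theorem genMeasure_nonneg (s : Fin k → G) {w : ℤ → ℝ} (hw : ∀ n, 0 ≤ w n) (g : G) :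
    0 ≤ genMeasure s w g := by
  unfold genMeasure
  refine mul_nonneg (by positivity) (Finset.sum_nonneg fun i _ => tsum_nonneg fun n => ?_)
  split_ifs
  · exact hw n
  · exact le_rfl

theorem ofReal_tsum_le {α : Type*} {u : α → ℝ} (hu : ∀ a, 0 ≤ u a) :
    ENNReal.ofReal (∑' a, u a) ≤ ∑' a, ENNReal.ofReal (u a) := by
  by_cases h : Summable u
  · rw [ENNReal.ofReal_tsum_of_nonneg hu h]
  · rw [tsum_eq_zero_of_not_summable h]; simp

theorem genMeasure_sum (f : G → ℝ) {w : ℤ → ℝ} (hw : ∀ n, 0 ≤ w n) :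
    ∑' y, NN f y * ENNReal.ofReal (genMeasure s w y) ≤
      ∑ i : Fin k, ∑' n : ℤ, NN f (s i ^ n) * ENNReal.ofReal (w n) := by
  have hpt : ∀ y, ENNReal.ofReal (genMeasure s w y) ≤
      ∑ i : Fin k, ∑' n : ℤ, if y = s i ^ n then ENNReal.ofReal (w n) else 0 := by
    intro y
    have h0 : ∀ i : Fin k, 0 ≤ ∑' n : ℤ, if y = s i ^ n then w n else 0 := fun i =>
      tsum_nonneg fun n => by split_ifs; exacts [hw n, le_rfl]
    calc ENNReal.ofReal (genMeasure s w y)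
        ≤ ENNReal.ofReal (∑ i : Fin k, ∑' n : ℤ, if y = s i ^ n then w n else 0) := by
          apply ENNReal.ofReal_le_ofReal
          unfold genMeasure
          refine mul_le_of_le_one_left (Finset.sum_nonneg fun i _ => h0 i) ?_
          exact Nat.cast_inv_le_one k
      _ = ∑ i : Fin k, ENNReal.ofReal (∑' n : ℤ, if y = s i ^ n then w n else 0) :=
          ENNReal.ofReal_sum_of_nonneg fun i _ => h0 i
      _ ≤ _ := by
          refine Finset.sum_le_sum fun i _ => ?_
          refine (ofReal_tsum_le fun n => by split_ifs; exacts [hw n, le_rfl]).trans (le_of_eq ?_)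
          refine tsum_congr fun n => ?_
          split_ifs <;> simp
  calc _ ≤ ∑' y, NN f y * ∑ i : Fin k, ∑' n : ℤ, if y = s i ^ n then ENNReal.ofReal (w n) else 0 :=
        ENNReal.tsum_le_tsum fun y => mul_le_mul_right (hpt y) _
    _ = ∑ i : Fin k, ∑' n : ℤ, ∑' y,
          NN f y * (if y = s i ^ n then ENNReal.ofReal (w n) else 0) := by
        simp_rw [Finset.mul_sum]
        rw [Summable.tsum_finsetSum (fun _ _ => ENNReal.summable)]
        refine Finset.sum_congr rfl fun i _ => ?_
        rw [ENNReal.tsum_comm]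
        refine tsum_congr fun y => ?_
        rw [ENNReal.tsum_mul_left]
    _ = _ := by
        refine Finset.sum_congr rfl fun i _ => tsum_congr fun n => ?_
        rw [tsum_eq_single (s i ^ n)]
        · simp
        · intro y hy; simp [hy]

theorem NN_sum_ne_top {f ν : G → ℝ} (hf : MemL2 f) (hν : ∀ g, 0 ≤ ν g) (hs : Summable ν) :
    ∑' y, NN f y * ENNReal.ofReal (ν y) ≠ ∞ := by
  have h1 : ∑' x, ENNReal.ofReal (f x ^ 2) ≠ ∞ := by
    rw [← ENNReal.ofReal_tsum_of_nonneg (fun x => sq_nonneg _) hf]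
    exact ENNReal.ofReal_ne_top
  have h2 : ∑' x, ENNReal.ofReal (ν x) ≠ ∞ := by
    rw [← ENNReal.ofReal_tsum_of_nonneg hν hs]
    exact ENNReal.ofReal_ne_top
  have h3 : ∑' y, NN f y * ENNReal.ofReal (ν y) ≤
      (4 * ∑' x, ENNReal.ofReal (f x ^ 2)) * ∑' x, ENNReal.ofReal (ν x) := by
    rw [← ENNReal.tsum_mul_left]
    exact ENNReal.tsum_le_tsum fun y => mul_le_mul_left (NN_le f y) _
  exact ne_top_of_le_ne_top (ENNReal.mul_ne_top (ENNReal.mul_ne_top (by simp) h1) h2) h3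

theorem finish {μ ν f : G → ℝ} (hμ : ∀ g, 0 ≤ μ g) (hν : ∀ g, 0 ≤ ν g) (hs : Summable ν)
    (hf : MemL2 f) {C : ℝ} (hC : 0 ≤ C)
    (h : ∑' y, NN f y * ENNReal.ofReal (μ y) ≤
      ENNReal.ofReal C * ∑' y, NN f y * ENNReal.ofReal (ν y)) :
    dirichlet μ f ≤ C * dirichlet ν f := by
  rw [dirichlet_eq μ f hμ, dirichlet_eq ν f hν]
  have h1 := ENNReal.toReal_mono (ENNReal.mul_ne_top ENNReal.ofReal_ne_top
    (NN_sum_ne_top hf hν hs)) h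
  rw [ENNReal.toReal_mul, ENNReal.toReal_ofReal hC] at h1
  linarith

end
end NC

/-- comparison of Dirichlet forms, `E_μ ≤ C E_ν`, for a nilpotent group:
`ν(g) = c/(V(1+|g|)ℓ(1+|g|))` radial, `μ` supported on powers of the generators. -/
theorem statement6 {G : Type*} [Group G] [Group.IsNilpotent G] {k : ℕ} (hk : 0 < k)
    (s : Fin k → G) (hgen : Subgroup.closure (Set.range s) = ⊤)
    (l : ℝ → ℝ) (hlcont : ContinuousOn l (Set.Ici 0))
    (hlpos : ∀ x, 0 ≤ x → 0 < l x) (hlmono : MonotoneOn l (Set.Ici 0))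
    (hlsv : SlowlyVarying l)
    (hsum : Summable (fun g : G =>
      1 / ((vol (symSet s) (1 + wordLen (symSet s) g) : ℝ) *
        l (1 + (wordLen (symSet s) g : ℝ))))) :
    ∃ C : ℝ, ∀ f : G → ℝ, MemL2 f →
      dirichlet
        (genMeasure s (fun n =>
          (∑' m : ℤ, 1 / ((1 + (|m| : ℝ)) * l (1 + (|m| : ℝ))))⁻¹ /
            ((1 + (|n| : ℝ)) * l (1 + (|n| : ℝ))))) f ≤
      C * dirichlet
        (fun g =>
          (∑' h : G, 1 / ((vol (symSet s) (1 + wordLen (symSet s) h) : ℝ) *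
            l (1 + (wordLen (symSet s) h : ℝ))))⁻¹ /
          ((vol (symSet s) (1 + wordLen (symSet s) g) : ℝ) *
            l (1 + (wordLen (symSet s) g : ℝ)))) f := by
  have hV : ∀ m, (0 : ℝ) < vol (symSet s) m := fun m => by
    exact_mod_cast NC.vol_pos hgen m
  have hden : ∀ g : G, 0 < 1 / ((vol (symSet s) (1 + wordLen (symSet s) g) : ℝ) *
      l (1 + (wordLen (symSet s) g : ℝ))) := fun g =>
    one_div_pos.2 (mul_pos (hV _) (hlpos _ (by positivity)))
  have hc : 0 < ∑' h : G, 1 / ((vol (symSet s) (1 + wordLen (symSet s) h) : ℝ) *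
      l (1 + (wordLen (symSet s) h : ℝ))) :=
    hsum.tsum_pos (fun g => (hden g).le) 1 (hden 1)
  set c := ∑' h : G, 1 / ((vol (symSet s) (1 + wordLen (symSet s) h) : ℝ) *
      l (1 + (wordLen (symSet s) h : ℝ))) with hcdef
  have hwn : ∀ n : ℤ, 0 ≤ 1 / ((1 + (|n| : ℝ)) * l (1 + (|n| : ℝ))) := fun n =>
    (one_div_pos.2 (mul_pos (by positivity) (hlpos _ (by positivity)))).le
  have hb : 0 ≤ ∑' m : ℤ, 1 / ((1 + (|m| : ℝ)) * l (1 + (|m| : ℝ))) := tsum_nonneg hwn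
  set b := ∑' m : ℤ, 1 / ((1 + (|m| : ℝ)) * l (1 + (|m| : ℝ))) with hbdef
  have hw : ∀ n : ℤ, 0 ≤ b⁻¹ / ((1 + (|n| : ℝ)) * l (1 + (|n| : ℝ))) := fun n => by
    rw [div_eq_mul_one_div]; exact mul_nonneg (inv_nonneg.2 hb) (hwn n)
  have hν : ∀ g : G, 0 < c⁻¹ / ((vol (symSet s) (1 + wordLen (symSet s) g) : ℝ) *
      l (1 + (wordLen (symSet s) g : ℝ))) := fun g => by
    rw [div_eq_mul_one_div]; exact mul_pos (inv_pos.2 hc) (hden g)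
  have hνs : Summable (fun g : G => c⁻¹ / ((vol (symSet s) (1 + wordLen (symSet s) g) : ℝ) *
      l (1 + (wordLen (symSet s) g : ℝ)))) := by
    simp_rw [div_eq_mul_one_div c⁻¹]; exact hsum.mul_left _
  have hμ := NC.genMeasure_nonneg s hw
  rcases finite_or_infinite G with hfin | hinf
  · have := Fintype.ofFinite G
    set μ := genMeasure s (fun n => b⁻¹ / ((1 + (|n| : ℝ)) * l (1 + (|n| : ℝ)))) with hμd
    set ν := fun g : G => c⁻¹ / ((vol (symSet s) (1 + wordLen (symSet s) g) : ℝ) *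
      l (1 + (wordLen (symSet s) g : ℝ))) with hνd
    have hr : ∀ g, 0 ≤ μ g / ν g := fun g => div_nonneg (hμ g) (hν g).le
    have hC : 0 ≤ ∑ g, μ g / ν g := Finset.sum_nonneg fun g _ => hr g
    refine ⟨∑ g, μ g / ν g, fun f hf => NC.finish hμ (fun g => (hν g).le) hνs hf hC ?_⟩
    rw [← ENNReal.tsum_mul_left]
    refine ENNReal.tsum_le_tsum fun y => ?_
    rw [mul_left_comm, ← ENNReal.ofReal_mul hC]
    gcongr
    have h1 : μ y / ν y ≤ ∑ g, μ g / ν g :=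
      Finset.single_le_sum (fun g _ => hr g) (Finset.mem_univ y)
    exact (div_le_iff₀ (hν y)).1 h1
  · obtain ⟨C, hC, hmain⟩ := NC.main_ineq (s := s) hgen hlpos hlmono hlsv
    refine ⟨k * (b⁻¹ * (C * c)), fun f hf =>
      NC.finish hμ (fun g => (hν g).le) hνs hf (by positivity) ?_⟩
    refine (NC.genMeasure_sum f hw).trans ?_
    have hb' : 0 ≤ b⁻¹ := inv_nonneg.2 hb
    have hci : 0 ≤ c⁻¹ := inv_nonneg.2 hc.le
    have e1 : ∑' y, NC.NN f y * ENNReal.ofReal (1 / ((vol (symSet s) (1 + wordLen (symSet s) y) : ℝ) *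
          l (1 + (wordLen (symSet s) y : ℝ)))) = ENNReal.ofReal c * ∑' y, NC.NN f y *
          ENNReal.ofReal (c⁻¹ / ((vol (symSet s) (1 + wordLen (symSet s) y) : ℝ) *
          l (1 + (wordLen (symSet s) y : ℝ)))) := by
      rw [← ENNReal.tsum_mul_left]
      refine tsum_congr fun y => ?_
      rw [mul_left_comm, ← ENNReal.ofReal_mul hc.le]
      congr 2
      rw [← mul_div_assoc, mul_inv_cancel₀ hc.ne']
    calc _ ≤ ∑ i : Fin k, ENNReal.ofReal b⁻¹ * (ENNReal.ofReal C * (ENNReal.ofReal c *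
          ∑' y, NC.NN f y *
          ENNReal.ofReal (c⁻¹ / ((vol (symSet s) (1 + wordLen (symSet s) y) : ℝ) *
          l (1 + (wordLen (symSet s) y : ℝ)))))) := by
          refine Finset.sum_le_sum fun i _ => ?_
          rw [← e1]
          refine le_trans (le_of_eq ?_) (mul_le_mul_right (hmain f i) _)
          rw [← ENNReal.tsum_mul_left]
          refine tsum_congr fun n => ?_
          rw [mul_left_comm, ← ENNReal.ofReal_mul hb', ← div_eq_mul_one_div]
      _ = _ := by
          rw [Finset.sum_const, Finset.card_univ, Fintype.card_fin, nsmul_eq_mul,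
            ENNReal.ofReal_mul (by positivity), ENNReal.ofReal_mul hb', ENNReal.ofReal_mul hC,
            ENNReal.ofReal_natCast]
          ring
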